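/- arXiv:2412.02123 — 4 statements merged into one kernel-verified Lean document; each statement's English description precedes it below -/
import Mathlib

section
/- Let K = K(n,m,Λ) be a Bedford–McMullen carpet (n > m ≥ 2) with log n / log m rational, not contained in any affine line of ℝ². Let f be an oblique isometry of ℝ² (a similitude with similarity ratio 1) such that f(K) ⊆ K. Then there exist z ∈ π₂(K), β ≠ 0 and c ∈ ℝ such that β·E(m,J) + c ⊆ K^z; that is, the horizontal slice K^z contains a nondegenerate scaled copy of the deleted-digit set E(m,J). -/
open scoped BigOperators

/-- The Bedford–McMullen carpet `K(n,m,Λ)`: the set of points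
`(Σ_k i_k n^{-k}, Σ_k j_k m^{-k})` with `(i_k, j_k) ∈ Λ` for all `k ≥ 1`. -/
def BMCarpet (n m : ℕ) (Λ : Finset (ℕ × ℕ)) : Set (ℝ × ℝ) :=
  { p | ∃ d : ℕ → ℕ × ℕ, (∀ k, d k ∈ Λ) ∧
      p.1 = ∑' k : ℕ, ((d k).1 : ℝ) / (n : ℝ) ^ (k + 1) ∧
      p.2 = ∑' k : ℕ, ((d k).2 : ℝ) / (m : ℝ) ^ (k + 1) }

/-- `f` is a similitude of the Euclidean plane with ratio `l`. -/
def IsSimilitude (f : ℝ × ℝ → ℝ × ℝ) (l : ℝ) : Prop :=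
  ∀ x y : ℝ × ℝ,
    Real.sqrt (((f x).1 - (f y).1) ^ 2 + ((f x).2 - (f y).2) ^ 2)
      = l * Real.sqrt ((x.1 - y.1) ^ 2 + (x.2 - y.2) ^ 2)

/-- `f` is oblique: both coordinates of `f (1,0) - f (0,0)` are nonzero. -/
def Oblique (f : ℝ × ℝ → ℝ × ℝ) : Prop :=
  (f (1, 0)).1 - (f (0, 0)).1 ≠ 0 ∧ (f (1, 0)).2 - (f (0, 0)).2 ≠ 0

/-- `K` is contained in some affine line of the plane. -/
def OnALine (K : Set (ℝ × ℝ)) : Prop :=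
  ∃ a b c : ℝ, (a ≠ 0 ∨ b ≠ 0) ∧ ∀ p ∈ K, a * p.1 + b * p.2 = c

/-- `I_j`: the digits of selected rectangles in the `j`-th row. -/
def rowDigits (Λ : Finset (ℕ × ℕ)) (j : ℕ) : Finset ℕ :=
  (Λ.filter fun p => p.2 = j).image Prod.fst

/-- `N = max_{0 ≤ j ≤ m-1} card I_j`. -/
def maxRowCard (m : ℕ) (Λ : Finset (ℕ × ℕ)) : ℕ :=
  Finset.sup (Finset.range m) fun j => (rowDigits Λ j).card

/-- The horizontal slice `K^y = { x : (x,y) ∈ K }`. -/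
def horizSlice (K : Set (ℝ × ℝ)) (y : ℝ) : Set ℝ := { x | (x, y) ∈ K }

/-- The deleted-digit set `E(q,D) = { Σ_{k≥1} ε_k q^{-k} : ε_k ∈ D }`. -/
def deletedDigitSet (q : ℕ) (D : Finset ℕ) : Set ℝ :=
  { x | ∃ d : ℕ → ℕ, (∀ k, d k ∈ D) ∧
      x = ∑' k : ℕ, ((d k) : ℝ) / (q : ℝ) ^ (k + 1) }

open Filter Topology

/-- A plane similitude of ratio `1` is affine; if it is oblique, the image of the vertical direction
has a nonzero horizontal component. -/
theorem IsSimilitude.exists_affine {f : ℝ × ℝ → ℝ × ℝ} (hf : IsSimilitude f 1)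
    (hob : Oblique f) :
    ∃ p q a b c e : ℝ, b ≠ 0 ∧ ∀ x y : ℝ, f (x, y) = (p + a * x + b * y, q + c * x + e * y) := by
  have hsq : ∀ x y : ℝ × ℝ, ((f x).1 - (f y).1) ^ 2 + ((f x).2 - (f y).2) ^ 2
      = (x.1 - y.1) ^ 2 + (x.2 - y.2) ^ 2 := by
    intro x y
    have h := hf x y
    rw [one_mul] at h
    exact (Real.sqrt_inj (by positivity) (by positivity)).1 h
  obtain ⟨-, hc⟩ := hob
  obtain ⟨p, hp⟩ : ∃ p, p = (f (0, 0)).1 := ⟨_, rfl⟩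
  obtain ⟨q, hq⟩ : ∃ q, q = (f (0, 0)).2 := ⟨_, rfl⟩
  obtain ⟨a, ha⟩ : ∃ a, a = (f (1, 0)).1 - p := ⟨_, rfl⟩
  obtain ⟨c, hc'⟩ : ∃ c, c = (f (1, 0)).2 - q := ⟨_, rfl⟩
  obtain ⟨b, hb⟩ : ∃ b, b = (f (0, 1)).1 - p := ⟨_, rfl⟩
  obtain ⟨e, he⟩ : ∃ e, e = (f (0, 1)).2 - q := ⟨_, rfl⟩
  have h1 := hsq (1, 0) (0, 0)
  have h2 := hsq (0, 1) (0, 0)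
  have h3 := hsq (1, 0) (0, 1)
  have f10 : (f (1, 0)).1 = a + p := by linarith
  have f10' : (f (1, 0)).2 = c + q := by linarith
  have f01 : (f (0, 1)).1 = b + p := by linarith
  have f01' : (f (0, 1)).2 = e + q := by linarith
  simp only [← hp, ← hq, f10, f10', f01, f01'] at h1 h2 h3 hc
  have hab : a * b + c * e = 0 := by linarith
  refine ⟨p, q, a, b, c, e, ?_, fun x y => ?_⟩
  · rintro rfl
    have hc0 : c ≠ 0 := by simpa using hc
    have he0 : e = 0 := by simpa [hc0] using hab
    subst he0
    norm_num at h2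
  · have g1 := hsq (x, y) (0, 0)
    have g2 := hsq (x, y) (1, 0)
    have g3 := hsq (x, y) (0, 1)
    simp only [← hp, ← hq, f10, f10', f01, f01'] at g1 g2 g3
    obtain ⟨X, hX⟩ : ∃ X, X = (f (x, y)).1 - p := ⟨_, rfl⟩
    obtain ⟨Y, hY⟩ : ∃ Y, Y = (f (x, y)).2 - q := ⟨_, rfl⟩
    have fX : (f (x, y)).1 = X + p := by linarith
    have fY : (f (x, y)).2 = Y + q := by linarith
    simp only [fX, fY] at g1 g2 g3
    have k1 : a * X + c * Y = x := by linarith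
    have k2 : b * X + e * Y = y := by linarith
    have key : (X - (a * x + b * y)) ^ 2 + (Y - (c * x + e * y)) ^ 2 = 0 := by
      linear_combination g1 + x ^ 2 * h1 + y ^ 2 * h2 + 2 * x * y * hab - 2 * x * k1 - 2 * y * k2
    have e1 : X - (a * x + b * y) = 0 :=
      pow_eq_zero_iff two_ne_zero |>.1 (by
        linarith [sq_nonneg (X - (a * x + b * y)), sq_nonneg (Y - (c * x + e * y))])
    have e2 : Y - (c * x + e * y) = 0 :=
      pow_eq_zero_iff two_ne_zero |>.1 (by
        linarith [sq_nonneg (X - (a * x + b * y)), sq_nonneg (Y - (c * x + e * y))])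
    ext
    · simp only [fX]; linarith
    · simp only [fY]; linarith

/-- The real number with base-`q` expansion `0.d₀d₁d₂…`. -/
noncomputable def digitValue (q : ℕ) (d : ℕ → ℕ) : ℝ :=
  ∑' k : ℕ, (d k : ℝ) / (q : ℝ) ^ (k + 1)

theorem digit_div_pow_le {q d : ℕ} (hq : 2 ≤ q) (hd : d < q) (k : ℕ) :
    (d : ℝ) / (q : ℝ) ^ (k + 1) ≤ (1 / (q : ℝ)) ^ k := by
  have hq0 : (0 : ℝ) < q := by positivity
  have hd' : (d : ℝ) ≤ q := by exact_mod_cast hd.le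
  rw [div_pow, one_pow, div_le_div_iff₀ (by positivity) (by positivity), pow_succ, one_mul,
    mul_comm]
  gcongr

theorem summable_one_div_pow_of_two_le {q : ℕ} (hq : 2 ≤ q) :
    Summable fun k : ℕ => (1 / (q : ℝ)) ^ k := by
  have hq' : (2 : ℝ) ≤ q := by exact_mod_cast hq
  apply summable_geometric_of_lt_one (by positivity)
  rw [div_lt_one (by positivity)]
  linarith

theorem summable_digit_div_pow {q : ℕ} (hq : 2 ≤ q) {d : ℕ → ℕ} (hd : ∀ k, d k < q) :
    Summable fun k : ℕ => (d k : ℝ) / (q : ℝ) ^ (k + 1) :=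
  Summable.of_nonneg_of_le (fun k => by positivity) (fun k => digit_div_pow_le hq (hd k) k)
    (summable_one_div_pow_of_two_le hq)

/-- Splitting off the first `l` digits. -/
theorem digitValue_eq_prefix_add {q : ℕ} (hq : 2 ≤ q) {d : ℕ → ℕ} (hd : ∀ k, d k < q) (l : ℕ) :
    digitValue q d = (∑ k ∈ Finset.range l, (d k : ℝ) / (q : ℝ) ^ (k + 1))
      + digitValue q (fun k => d (k + l)) / (q : ℝ) ^ l := by
  unfold digitValue
  rw [← (summable_digit_div_pow hq hd).sum_add_tsum_nat_add l, ← tsum_div_const]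
  congr 1
  refine tsum_congr fun k => ?_
  rw [div_div, ← pow_add]
  congr 2
  ring

theorem exists_int_pow_mul_digitValue {q : ℕ} (hq : 2 ≤ q) {d : ℕ → ℕ} (hd : ∀ k, d k < q)
    (l : ℕ) : ∃ i : ℤ, (q : ℝ) ^ l * digitValue q d = i + digitValue q (fun k => d (k + l)) := by
  have hq0 : (q : ℝ) ≠ 0 := by positivity
  refine ⟨∑ k ∈ Finset.range l, (d k : ℤ) * (q : ℤ) ^ (l - (k + 1)), ?_⟩
  rw [digitValue_eq_prefix_add hq hd l, mul_add, mul_div_cancel₀ _ (pow_ne_zero _ hq0),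
    Finset.mul_sum]
  congr 1
  push_cast
  refine Finset.sum_congr rfl fun k hk => ?_
  have hk' : l = (l - (k + 1)) + (k + 1) := by
    have := Finset.mem_range.1 hk
    omega
  rw [mul_div_assoc', div_eq_iff (pow_ne_zero _ hq0), mul_assoc, ← pow_add, ← hk', mul_comm]

theorem continuous_digitValue {α : Type*} [TopologicalSpace α] [DiscreteTopology α] {q : ℕ}
    (hq : 2 ≤ q) (g : α → ℕ) (hg : ∀ x, g x < q) :
    Continuous fun d : ℕ → α => digitValue q (fun k => g (d k)) := by
  refine continuous_tsum (fun k => ?_) (summable_one_div_pow_of_two_le hq) fun k d => ?_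
  · have : Continuous fun x : α => (g x : ℝ) / (q : ℝ) ^ (k + 1) := continuous_of_discreteTopology
    exact this.comp (continuous_apply k)
  · rw [Real.norm_of_nonneg (by positivity)]
    exact digit_div_pow_le hq (hg _) k

/-- The sequence whose first `h` terms are those of `u` and which continues with `v`. -/
def spliceAt {α : Type*} (h : ℕ) (u v : ℕ → α) : ℕ → α :=
  fun k => if k < h then u k else v (k - h)

theorem digitValue_spliceAt {α : Type*} {q : ℕ} (hq : 2 ≤ q) (g : α → ℕ) (hg : ∀ x, g x < q)
    (h : ℕ) (u v : ℕ → α) :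
    digitValue q (fun k => g (spliceAt h u v k))
      = (∑ k ∈ Finset.range h, (g (u k) : ℝ) / (q : ℝ) ^ (k + 1))
        + digitValue q (fun k => g (v k)) / (q : ℝ) ^ h := by
  rw [digitValue_eq_prefix_add hq (fun k => hg _) h]
  congr 1
  · refine Finset.sum_congr rfl fun k hk => ?_
    simp [spliceAt, Finset.mem_range.1 hk]
  · simp [spliceAt]

/-- A neighbourhood in the sequence space over a discrete alphabet contains a cylinder. -/
theorem exists_forall_spliceAt_mem {α : Type*} [TopologicalSpace α] [DiscreteTopology α]
    {u : ℕ → α} {U : Set (ℕ → α)} (hU : U ∈ 𝓝 u) : ∃ h, ∀ v, spliceAt h u v ∈ U := by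
  have hlim : ∀ w : ℕ → ℕ → α, Tendsto (fun h => spliceAt h u (w h)) atTop (𝓝 u) := by
    intro w
    refine tendsto_pi_nhds.2 fun k => tendsto_const_nhds.congr' ?_
    filter_upwards [eventually_gt_atTop k] with h hk
    simp [spliceAt, hk]
  by_contra! hcon
  choose w hw using hcon
  obtain ⟨h, hh⟩ := ((hlim w).eventually hU).exists
  exact hw h hh

theorem exists_pow_eq_pow_of_log_div_log {n m : ℕ} (hm : 2 ≤ m) (hnm : m < n)
    (hrat : ∃ q : ℚ, Real.log n / Real.log m = (q : ℝ)) :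
    ∃ p q : ℕ, p < q ∧ n ^ p = m ^ q := by
  obtain ⟨r, hr⟩ := hrat
  have hm1 : (1 : ℝ) < m := by exact_mod_cast hm
  have hn1 : (1 : ℝ) < n := by exact_mod_cast (by omega : 1 < n)
  have hlm := Real.log_pos hm1
  have hln := Real.log_pos hn1
  have hr0 : 0 < r := by
    have : (0 : ℝ) < r := hr ▸ div_pos hln hlm
    exact_mod_cast this
  obtain ⟨q, hq⟩ := Int.eq_ofNat_of_zero_le (Rat.num_pos.2 hr0).le
  have hden : (r.den : ℝ) ≠ 0 := by exact_mod_cast r.den_nz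
  have hpq : n ^ r.den = m ^ q := by
    have h : (r.den : ℝ) * Real.log n = q * Real.log m := by
      rw [Rat.cast_def, hq] at hr
      push_cast at hr
      field_simp at hr
      linarith
    rw [← Real.log_pow, ← Real.log_pow] at h
    have := Real.log_injOn_pos (Set.mem_Ioi.2 (by positivity)) (Set.mem_Ioi.2 (by positivity)) h
    exact_mod_cast this
  refine ⟨r.den, q, ?_, hpq⟩
  by_contra! hle
  have h1 : m ^ q ≤ m ^ r.den := Nat.pow_le_pow_right (by omega) hle
  have h2 : m ^ r.den < n ^ r.den := Nat.pow_lt_pow_left hnm r.den_nz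
  omega

theorem tendsto_pow_mul_div_pow_mul {b p q : ℕ} (hb : 2 ≤ b) (hpq : p < q) :
    Tendsto (fun t : ℕ => (b : ℝ) ^ (p * t) / (b : ℝ) ^ (q * t)) atTop (𝓝 0) := by
  have hb1 : (1 : ℝ) < b := by exact_mod_cast hb
  have : (fun t : ℕ => (b : ℝ) ^ (p * t) / (b : ℝ) ^ (q * t))
      = fun t : ℕ => ((b : ℝ) ^ p / (b : ℝ) ^ q) ^ t := by
    funext t
    rw [div_pow, pow_mul, pow_mul]
  rw [this]
  refine tendsto_pow_atTop_nhds_zero_of_lt_one (by positivity) ?_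
  rw [div_lt_one (by positivity)]
  exact pow_lt_pow_right₀ hb1 hpq

/-- A limit of integers is an integer. -/
theorem exists_int_eq_of_tendsto {ι : Type*} {l : Filter ι} [l.NeBot] {i : ι → ℤ} {x : ℝ}
    (h : Tendsto (fun t => (i t : ℝ)) l (𝓝 x)) : ∃ j : ℤ, (j : ℝ) = x :=
  Int.isClosedEmbedding_coe_real.isClosed_range.mem_of_tendsto h
    (Eventually.of_forall fun t => ⟨i t, rfl⟩)

theorem Ultrafilter.exists_tendsto_fract {ι : Type*} (F : Ultrafilter ι) (u : ι → ℝ) :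
    ∃ r, Tendsto (fun t => Int.fract (u t)) F (𝓝 r) := by
  have hle : (F.map fun t => Int.fract (u t) : Filter ℝ) ≤ 𝓟 (Set.Icc 0 1) := by
    rw [le_principal_iff]
    exact Filter.mem_map.2 (Eventually.of_forall fun t =>
      ⟨Int.fract_nonneg _, (Int.fract_lt_one _).le⟩)
  obtain ⟨r, -, hr⟩ := isCompact_Icc.ultrafilter_le_nhds _ hle
  exact ⟨r, hr⟩

theorem Ultrafilter.exists_tendsto_of_compactSpace {ι X : Type*} [TopologicalSpace X]
    [CompactSpace X] (F : Ultrafilter ι) (u : ι → X) : ∃ x, Tendsto u F (𝓝 x) := by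
  obtain ⟨x, -, hx⟩ := isCompact_univ.ultrafilter_le_nhds (F.map u) (by simp)
  exact ⟨x, hx⟩

/-- The point of the plane coded by a sequence of digit pairs. -/
noncomputable def codedPoint (n m : ℕ) {Λ : Finset (ℕ × ℕ)} (d : ℕ → Λ) : ℝ × ℝ :=
  (digitValue n (fun k => (d k).1.1), digitValue m (fun k => (d k).1.2))

theorem BMCarpet_eq_range_codedPoint (n m : ℕ) (Λ : Finset (ℕ × ℕ)) :
    BMCarpet n m Λ = Set.range (codedPoint n m (Λ := Λ)) := by
  ext p
  constructor
  · rintro ⟨d, hd, h1, h2⟩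
    exact ⟨fun k => ⟨d k, hd k⟩, Prod.ext h1.symm h2.symm⟩
  · rintro ⟨d, rfl⟩
    exact ⟨fun k => (d k).1, fun k => (d k).2, rfl, rfl⟩

theorem exists_digitValue_eq_of_mem_deletedDigitSet {m : ℕ} {Λ : Finset (ℕ × ℕ)} {t : ℝ}
    (ht : t ∈ deletedDigitSet m (Λ.image Prod.snd)) :
    ∃ d : ℕ → Λ, digitValue m (fun k => (d k).1.2) = t := by
  obtain ⟨d, hd, rfl⟩ := ht
  have : ∀ k, ∃ x : Λ, x.1.2 = d k := by
    intro k
    obtain ⟨x, hx, hxd⟩ := Finset.mem_image.1 (hd k)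
    exact ⟨⟨x, hx⟩, hxd⟩
  choose x hx using this
  exact ⟨x, by simp only [hx]; rfl⟩

/-- If `n ^ p = m ^ q`, the sheared images of thin vertical cylinders, rescaled by the affine
expansions of the carpet, accumulate on horizontal slices: up to integer translations, every
`b * y` with `y` in the vertical projection occurs in such a slice. -/
theorem exists_int_translate_mem_BMCarpet {n m : ℕ} {Λ : Finset (ℕ × ℕ)} (hm : 2 ≤ m) (hnm : m ≤ n)
    (h1 : ∀ x : Λ, x.1.1 < n) (h2 : ∀ x : Λ, x.1.2 < m) (w : Λ) {p q : ℕ} (hpq : p < q)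
    (hpow : n ^ p = m ^ q) {f : ℝ × ℝ → ℝ × ℝ} {p₀ q₀ a b c e : ℝ}
    (haff : ∀ x y : ℝ, f (x, y) = (p₀ + a * x + b * y, q₀ + c * x + e * y))
    (hsub : f '' BMCarpet n m Λ ⊆ BMCarpet n m Λ) :
    ∃ r s : ℝ, ∀ d : ℕ → Λ, ∃ i j : ℤ,
      (i + r + b * (codedPoint n m d).2, j + s) ∈ BMCarpet n m Λ := by
  rw [BMCarpet_eq_range_codedPoint] at hsub ⊢
  have hn : 2 ≤ n := hm.trans hnm
  have hn0 : (n : ℝ) ≠ 0 := by positivity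
  have hm0 : (m : ℝ) ≠ 0 := by positivity
  have hpow' : ∀ t, (n : ℝ) ^ (p * t) = (m : ℝ) ^ (q * t) := by
    intro t
    rw [pow_mul, pow_mul]
    congr 1
    exact_mod_cast hpow
  let F : Ultrafilter ℕ := hyperfilter ℕ
  have hF : (F : Filter ℕ) ≤ atTop := Nat.hyperfilter_le_atTop
  let x₀ : ℕ → ℝ := fun k => ∑ i ∈ Finset.range k, (w.1.1 : ℝ) / (n : ℝ) ^ (i + 1)
  let y₀ : ℕ → ℝ := fun k => ∑ i ∈ Finset.range k, (w.1.2 : ℝ) / (m : ℝ) ^ (i + 1)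
  let u : ℕ → ℝ := fun t => (n : ℝ) ^ (p * t) * (p₀ + a * x₀ (q * t) + b * y₀ (q * t))
  let v : ℕ → ℝ := fun t => (m : ℝ) ^ (p * t) * (q₀ + c * x₀ (q * t) + e * y₀ (q * t))
  obtain ⟨r, hr⟩ := F.exists_tendsto_fract u
  obtain ⟨s, hs⟩ := F.exists_tendsto_fract v
  refine ⟨r, s, fun d => ?_⟩
  obtain ⟨X, hX⟩ : ∃ X, X = (codedPoint n m d).1 := ⟨_, rfl⟩
  obtain ⟨Y, hY⟩ : ∃ Y, Y = (codedPoint n m d).2 := ⟨_, rfl⟩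
  rw [← hY]
  have hstep : ∀ t : ℕ, ∃ g : ℕ → Λ, ∃ i j : ℤ,
      (codedPoint n m g).1 = i + Int.fract (u t) + b * Y
        + a * X * ((n : ℝ) ^ (p * t) / (n : ℝ) ^ (q * t)) ∧
      (codedPoint n m g).2 = j + Int.fract (v t)
        + (c * X * ((m : ℝ) ^ (p * t) / (n : ℝ) ^ (q * t))
        + e * Y * ((m : ℝ) ^ (p * t) / (m : ℝ) ^ (q * t))) := by
    intro t
    have hcyl : codedPoint n m (spliceAt (q * t) (fun _ => w) d)
        = (x₀ (q * t) + X / (n : ℝ) ^ (q * t), y₀ (q * t) + Y / (m : ℝ) ^ (q * t)) := by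
      rw [hX, hY]
      exact Prod.ext (digitValue_spliceAt hn (fun x : Λ => x.1.1) h1 _ _ _)
        (digitValue_spliceAt hm (fun x : Λ => x.1.2) h2 _ _ _)
    obtain ⟨g, hg⟩ := hsub ⟨_, ⟨spliceAt (q * t) (fun _ => w) d, rfl⟩, rfl⟩
    rw [hcyl, haff] at hg
    obtain ⟨i, hi⟩ := exists_int_pow_mul_digitValue hn (d := fun k => (g k).1.1)
      (fun k => h1 _) (p * t)
    obtain ⟨j, hj⟩ := exists_int_pow_mul_digitValue hm (d := fun k => (g k).1.2)
      (fun k => h2 _) (p * t)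
    have hg1 : digitValue n (fun k => (g k).1.1) = _ := congrArg Prod.fst hg
    have hg2 : digitValue m (fun k => (g k).1.2) = _ := congrArg Prod.snd hg
    rw [hg1] at hi
    rw [hg2] at hj
    have hu := Int.floor_add_fract (u t)
    have hv := Int.floor_add_fract (v t)
    refine ⟨fun k => g (k + p * t), ⌊u t⌋ - i, ⌊v t⌋ - j, ?_, ?_⟩
    · have hbY : (n : ℝ) ^ (p * t) * (b * (Y / (m : ℝ) ^ (q * t))) = b * Y := by
        rw [hpow']
        field_simp
      simp only [codedPoint]
      push_cast
      simp only [u] at hu ⊢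
      linear_combination -hi - hu + hbY
    · simp only [codedPoint]
      push_cast
      simp only [v] at hv ⊢
      linear_combination -hj - hv
  choose g i j hgi hgj using hstep
  obtain ⟨g₀, hg₀⟩ := F.exists_tendsto_of_compactSpace g
  have hc1 : Tendsto (fun t => (codedPoint n m (g t)).1) F (𝓝 (codedPoint n m g₀).1) :=
    ((continuous_digitValue hn (fun x : Λ => x.1.1) h1).tendsto g₀).comp hg₀
  have hc2 : Tendsto (fun t => (codedPoint n m (g t)).2) F (𝓝 (codedPoint n m g₀).2) :=
    ((continuous_digitValue hm (fun x : Λ => x.1.2) h2).tendsto g₀).comp hg₀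
  have hnn := (tendsto_pow_mul_div_pow_mul hn hpq).mono_left hF
  have hmm := (tendsto_pow_mul_div_pow_mul hm hpq).mono_left hF
  have hmn : Tendsto (fun t : ℕ => (m : ℝ) ^ (p * t) / (n : ℝ) ^ (q * t)) F (𝓝 0) := by
    have hnm' : (m : ℝ) ≤ n := by exact_mod_cast hnm
    refine squeeze_zero (fun t => by positivity) (fun t => ?_) hmm
    gcongr
  have hi := (((hc1.sub hr).sub_const (b * Y)).sub (hnn.const_mul (a * X)))
  have hj := ((hc2.sub hs).sub ((hmn.const_mul (c * X)).add (hmm.const_mul (e * Y))))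
  obtain ⟨i₀, hi₀⟩ := exists_int_eq_of_tendsto (i := i) (hi.congr fun t => by rw [hgi]; ring)
  obtain ⟨j₀, hj₀⟩ := exists_int_eq_of_tendsto (i := j) (hj.congr fun t => by rw [hgj]; ring)
  refine ⟨i₀, j₀, g₀, Prod.ext ?_ ?_⟩
  · simp only [hi₀]; ring
  · simp only [hj₀]; ring


theorem isometry_slice_contains_scaled_EmJ
    (n m : ℕ) (Λ : Finset (ℕ × ℕ))
    (hm : 2 ≤ m) (hnm : m < n)
    (hΛsub : Λ ⊆ Finset.range n ×ˢ Finset.range m)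
    (hΛ1 : 1 < Λ.card) (hΛ2 : Λ.card < m * n)
    (hrat : ∃ q : ℚ, Real.log n / Real.log m = (q : ℝ))
    (hline : ¬ OnALine (BMCarpet n m Λ))
    (f : ℝ × ℝ → ℝ × ℝ)
    (hf : IsSimilitude f 1)
    (hob : Oblique f)
    (hsub : f '' BMCarpet n m Λ ⊆ BMCarpet n m Λ) :
    ∃ z : ℝ, z ∈ Prod.snd '' BMCarpet n m Λ ∧
      ∃ β c : ℝ, β ≠ 0 ∧
        (fun t => β * t + c) '' deletedDigitSet m (Λ.image Prod.snd)
          ⊆ horizSlice (BMCarpet n m Λ) z := by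
  obtain ⟨p₀, q₀, a, b, c, e, hb, haff⟩ := hf.exists_affine hob
  obtain ⟨p, q, hpq, hpow⟩ := exists_pow_eq_pow_of_log_div_log hm hnm hrat
  have h1 : ∀ x : Λ, x.1.1 < n := fun x =>
    Finset.mem_range.1 (Finset.mem_product.1 (hΛsub x.2)).1
  have h2 : ∀ x : Λ, x.1.2 < m := fun x =>
    Finset.mem_range.1 (Finset.mem_product.1 (hΛsub x.2)).2
  have hn : 2 ≤ n := by omega
  obtain ⟨w, hw⟩ : Λ.Nonempty := Finset.card_pos.1 (by omega)
  have : Nonempty Λ := ⟨⟨w, hw⟩⟩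
  obtain ⟨r, s, hrs⟩ := exists_int_translate_mem_BMCarpet hm hnm.le h1 h2 ⟨w, hw⟩ hpq hpow haff hsub
  have hc1 := continuous_digitValue hn (fun x : Λ => x.1.1) h1
  have hc2 := continuous_digitValue hm (fun x : Λ => x.1.2) h2
  have hK : IsClosed (BMCarpet n m Λ) := by
    rw [BMCarpet_eq_range_codedPoint]
    exact (isCompact_range (hc1.prodMk hc2)).isClosed
  obtain ⟨⟨i, j⟩, u, hu⟩ := nonempty_interior_of_iUnion_of_closed
    (f := fun ij : ℤ × ℤ => {d : ℕ → Λ |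
      ((ij.1 : ℝ) + r + b * digitValue m (fun k => (d k).1.2), (ij.2 : ℝ) + s) ∈ BMCarpet n m Λ})
    (fun ij => hK.preimage (by fun_prop))
    (Set.eq_univ_of_forall fun d => by
      obtain ⟨i, j, hij⟩ := hrs d
      exact Set.mem_iUnion.2 ⟨(i, j), hij⟩)
  obtain ⟨h, hh⟩ := exists_forall_spliceAt_mem (mem_interior_iff_mem_nhds.1 hu)
  have hm0 : (m : ℝ) ≠ 0 := by positivity
  refine ⟨j + s, ⟨_, hh u, rfl⟩, b / (m : ℝ) ^ h,
    i + r + b * ∑ k ∈ Finset.range h, ((u k).1.2 : ℝ) / (m : ℝ) ^ (k + 1),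
    div_ne_zero hb (pow_ne_zero _ hm0), ?_⟩
  rintro _ ⟨t, ht, rfl⟩
  obtain ⟨d, rfl⟩ := exists_digitValue_eq_of_mem_deletedDigitSet ht
  have hd := hh d
  rw [Set.mem_ofPred_eq, digitValue_spliceAt hm (fun x : Λ => x.1.2) h2] at hd
  change (_, _) ∈ BMCarpet n m Λ
  convert hd using 2
  ring
end

section
/- Let K = K(n,Λ) be a generalized Sierpiński carpet satisfying the strong separation condition and not contained in any affine line of ℝ², and let P be the convex hull of K. Then for every extreme point v of P and every edge e of P having v as an endpoint, v is an accumulation point of K ∩ e; that is, there exists a sequence of points of (K ∩ e) \ {v} converging to v. -/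
open scoped BigOperators

/-- The map `φ_{i,j}(x,y) = ((x+i)/n, (y+j)/n)` of the generalized Sierpiński carpet IFS. -/
noncomputable def sierpMap (n : ℕ) (ij : ℕ × ℕ) (p : ℝ × ℝ) : ℝ × ℝ :=
  ((p.1 + ij.1) / n, (p.2 + ij.2) / n)

/-- The strong separation condition for the generalized Sierpiński carpet. -/
def StrongSep (n : ℕ) (Λ : Finset (ℕ × ℕ)) : Prop :=
  ∀ a ∈ Λ, ∀ b ∈ Λ, a ≠ b →
    Disjoint (sierpMap n a '' BMCarpet n n Λ) (sierpMap n b '' BMCarpet n n Λ)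

/-- `e` is an edge of the polygon `P`: a maximal nondegenerate closed segment
contained in the topological frontier of `P`. -/
def IsEdge (P e : Set (ℝ × ℝ)) : Prop :=
  (∃ a b : ℝ × ℝ, a ≠ b ∧ e = segment ℝ a b) ∧ e ⊆ frontier P ∧
    ∀ a b : ℝ × ℝ, e ⊆ segment ℝ a b → segment ℝ a b ⊆ frontier P →
      segment ℝ a b = e

theorem summable_digits {n : ℕ} (hn : 2 ≤ n) {u : ℕ → ℕ} (hu : ∀ k, u k < n) :
    Summable fun k => (u k : ℝ) / (n : ℝ) ^ (k + 1) := by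
  have hn0 : (0 : ℝ) < n := by positivity
  have hg : Summable fun k : ℕ => ((1 : ℝ) / n) ^ k :=
    summable_geometric_of_lt_one (by positivity) (by
      rw [div_lt_one hn0]
      exact_mod_cast hn)
  refine Summable.of_nonneg_of_le (fun k => by positivity) (fun k => ?_) hg
  rw [div_pow, one_pow, pow_succ, div_le_div_iff₀ (by positivity) (by positivity), one_mul, mul_comm]
  exact mul_le_mul_of_nonneg_left (by exact_mod_cast (hu k).le) (by positivity)

theorem tsum_digits_update {n : ℕ} (hn : 2 ≤ n) {u : ℕ → ℕ} (hu : ∀ k, u k < n) (N b : ℕ) :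
    ∑' k, (Function.update u N b k : ℝ) / (n : ℝ) ^ (k + 1)
      = (∑' k, (u k : ℝ) / (n : ℝ) ^ (k + 1)) + ((b : ℝ) - u N) / (n : ℝ) ^ (N + 1) := by
  have h := (summable_digits hn hu).hasSum.update N ((b : ℝ) / (n : ℝ) ^ (N + 1))
  rw [show (fun k => (Function.update u N b k : ℝ) / (n : ℝ) ^ (k + 1))
      = Function.update (fun k => (u k : ℝ) / (n : ℝ) ^ (k + 1)) N ((b : ℝ) / (n : ℝ) ^ (N + 1)) from ?_,
    h.tsum_eq]
  · ring
  · funext k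
    by_cases hk : k = N
    · subst hk; simp
    · simp [Function.update_of_ne hk]

/-- Replacing one digit of a point of the carpet moves it by the scaled digit difference. -/
theorem digit_change_mem {n : ℕ} {Λ : Finset (ℕ × ℕ)} (hn : 2 ≤ n)
    (hΛ : Λ ⊆ Finset.range n ×ˢ Finset.range n) {d : ℕ → ℕ × ℕ} (hd : ∀ k, d k ∈ Λ) {v : ℝ × ℝ}
    (h1 : v.1 = ∑' k : ℕ, ((d k).1 : ℝ) / (n : ℝ) ^ (k + 1))
    (h2 : v.2 = ∑' k : ℕ, ((d k).2 : ℝ) / (n : ℝ) ^ (k + 1)) (N : ℕ) {b : ℕ × ℕ} (hb : b ∈ Λ) :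
    (v.1 + ((b.1 : ℝ) - (d N).1) / (n : ℝ) ^ (N + 1),
      v.2 + ((b.2 : ℝ) - (d N).2) / (n : ℝ) ^ (N + 1)) ∈ BMCarpet n n Λ := by
  have hlt : ∀ k, (d k).1 < n ∧ (d k).2 < n := fun k => by simpa using hΛ (hd k)
  refine ⟨Function.update d N b, fun k => ?_, ?_, ?_⟩
  · by_cases hk : k = N
    · subst hk; simpa using hb
    · simpa [Function.update_of_ne hk] using hd k
  · rw [h1, ← tsum_digits_update hn (fun k => (hlt k).1)]
    refine tsum_congr fun k => ?_
    by_cases hk : k = N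
    · subst hk; simp
    · simp [Function.update_of_ne hk]
  · rw [h2, ← tsum_digits_update hn (fun k => (hlt k).2)]
    refine tsum_congr fun k => ?_
    by_cases hk : k = N
    · subst hk; simp
    · simp [Function.update_of_ne hk]

/-- A linear form on the carpet is dominated by a digit sequence that dominates it digitwise. -/
theorem linear_le_of_digits_le {n : ℕ} {Λ : Finset (ℕ × ℕ)} (hn : 2 ≤ n)
    (hΛ : Λ ⊆ Finset.range n ×ˢ Finset.range n) {d : ℕ → ℕ × ℕ} (hd : ∀ k, d k ∈ Λ) {v : ℝ × ℝ}
    (h1 : v.1 = ∑' k : ℕ, ((d k).1 : ℝ) / (n : ℝ) ^ (k + 1))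
    (h2 : v.2 = ∑' k : ℕ, ((d k).2 : ℝ) / (n : ℝ) ^ (k + 1)) {α β : ℝ}
    (hmax : ∀ k, ∀ b ∈ Λ, α * b.1 + β * b.2 ≤ α * (d k).1 + β * (d k).2) :
    ∀ p ∈ BMCarpet n n Λ, α * p.1 + β * p.2 ≤ α * v.1 + β * v.2 := by
  rintro p ⟨d', hd', p1, p2⟩
  have key : ∀ (c : ℕ → ℕ × ℕ), (∀ k, c k ∈ Λ) →
      HasSum (fun k => α * (((c k).1 : ℝ) / (n : ℝ) ^ (k + 1)) + β * (((c k).2 : ℝ) / (n : ℝ) ^ (k + 1)))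
        (α * (∑' k : ℕ, ((c k).1 : ℝ) / (n : ℝ) ^ (k + 1))
          + β * (∑' k : ℕ, ((c k).2 : ℝ) / (n : ℝ) ^ (k + 1))) := fun c hc => by
    have hlt : ∀ k, (c k).1 < n ∧ (c k).2 < n := fun k => by simpa using hΛ (hc k)
    exact ((summable_digits hn fun k => (hlt k).1).hasSum.mul_left α).add
      ((summable_digits hn fun k => (hlt k).2).hasSum.mul_left β)
  rw [p1, p2, h1, h2]
  refine hasSum_le (fun k => ?_) (key d' hd') (key d hd)
  have := div_le_div_of_nonneg_right (hmax k _ (hd' k)) (by positivity : (0 : ℝ) ≤ (n : ℝ) ^ (k + 1))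
  calc _ = (α * (d' k).1 + β * (d' k).2) / (n : ℝ) ^ (k + 1) := by ring
    _ ≤ _ := this
    _ = _ := by ring

theorem convex_halfplane (α β M : ℝ) : Convex ℝ {p : ℝ × ℝ | α * p.1 + β * p.2 ≤ M} := by
  refine convex_halfSpace_le ⟨fun x y => ?_, fun c x => ?_⟩ M
  · simp only [Prod.fst_add, Prod.snd_add]; ring
  · simp only [Prod.smul_fst, Prod.smul_snd, smul_eq_mul]; ring

theorem closure_convexHull_subset_halfplane {K : Set (ℝ × ℝ)} {α β M : ℝ}
    (h : ∀ p ∈ K, α * p.1 + β * p.2 ≤ M) :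
    ∀ p ∈ closure (convexHull ℝ K), α * p.1 + β * p.2 ≤ M := by
  have hc : IsClosed {p : ℝ × ℝ | α * p.1 + β * p.2 ≤ M} :=
    isClosed_le (by fun_prop) continuous_const
  exact closure_minimal (convexHull_min h (convex_halfplane α β M)) hc

theorem linear_form_apply (f : (ℝ × ℝ) →ₗ[ℝ] ℝ) (p : ℝ × ℝ) :
    f p = f (1, 0) * p.1 + f (0, 1) * p.2 := by
  have : p = p.1 • ((1 : ℝ), (0 : ℝ)) + p.2 • ((0 : ℝ), (1 : ℝ)) := by ext <;> simp
  conv_lhs => rw [this]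
  rw [map_add, map_smul, map_smul, smul_eq_mul, smul_eq_mul]; ring

theorem affineSpan_eq_top_of_not_onALine {K : Set (ℝ × ℝ)} (h : ¬ OnALine K) :
    affineSpan ℝ K = ⊤ := by
  rcases K.eq_empty_or_nonempty with rfl | hne
  · exact absurd ⟨1, 0, 0, by simp, by simp⟩ h
  by_contra hspan
  rw [AffineSubspace.affineSpan_eq_top_iff_vectorSpan_eq_top_of_nonempty _ _ _ hne] at hspan
  obtain ⟨f, hf0, hf⟩ := Submodule.exists_le_ker_of_lt_top _ (lt_top_iff_ne_top.2 hspan)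
  obtain ⟨q, hq⟩ := hne
  refine h ⟨f (1, 0), f (0, 1), f q, ?_, fun p hp => ?_⟩
  · by_contra! hc
    refine hf0 (LinearMap.ext fun p => ?_)
    rw [linear_form_apply, hc.1, hc.2]; simp
  · rw [← linear_form_apply]
    have := hf (vsub_mem_vectorSpan ℝ hp hq)
    rw [LinearMap.mem_ker, vsub_eq_sub, map_sub] at this
    linarith

/-- A planar set not on a line has a supporting line at every frontier point of its convex hull. -/
theorem exists_supporting_line {K : Set (ℝ × ℝ)} (h : ¬ OnALine K) {m : ℝ × ℝ}
    (hm : m ∈ frontier (convexHull ℝ K)) :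
    ∃ a b : ℝ, (a ≠ 0 ∨ b ≠ 0) ∧
      (∀ p ∈ interior (convexHull ℝ K), a * p.1 + b * p.2 < a * m.1 + b * m.2) ∧
      ∀ p ∈ closure (convexHull ℝ K), a * p.1 + b * p.2 ≤ a * m.1 + b * m.2 := by
  have hint : (interior (convexHull ℝ K)).Nonempty :=
    interior_convexHull_nonempty_iff_affineSpan_eq_top.2 (affineSpan_eq_top_of_not_onALine h)
  have hconv := convex_convexHull ℝ K
  obtain ⟨f, hf⟩ := geometric_hahn_banach_open_point hconv.interior isOpen_interior hm.2
  have hfe : ∀ p, f p = f (1, 0) * p.1 + f (0, 1) * p.2 := fun p =>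
    linear_form_apply (f : (ℝ × ℝ) →ₗ[ℝ] ℝ) p
  have hlt : ∀ p ∈ interior (convexHull ℝ K),
      f (1, 0) * p.1 + f (0, 1) * p.2 < f (1, 0) * m.1 + f (0, 1) * m.2 := fun p hp => by
    rw [← hfe, ← hfe]; exact hf p hp
  refine ⟨f (1, 0), f (0, 1), ?_, hlt, fun p hp => ?_⟩
  · by_contra! hc
    obtain ⟨q, hq⟩ := hint
    have := hlt q hq
    simp [hc.1, hc.2] at this
  · rw [← hconv.closure_interior_eq_closure_of_nonempty_interior hint] at hp
    exact closure_minimal (t := {p : ℝ × ℝ | f (1, 0) * p.1 + f (0, 1) * p.2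
      ≤ f (1, 0) * m.1 + f (0, 1) * m.2}) (fun p hp => (hlt p hp).le)
      (isClosed_le (by fun_prop) continuous_const) hp

/-- Three points on a line of the plane: one of them lies between the other two. -/
theorem mem_segment_trichotomy_of_line {a b : ℝ} (hab : a ≠ 0 ∨ b ≠ 0) {v w p : ℝ × ℝ}
    (hw : a * w.1 + b * w.2 = a * v.1 + b * v.2)
    (hp : a * p.1 + b * p.2 = a * v.1 + b * v.2) :
    p ∈ segment ℝ v w ∨ w ∈ segment ℝ v p ∨ v ∈ segment ℝ p w := by
  have hcol : Collinear ℝ {v, w, p} := by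
    rw [collinear_iff_of_mem (p₀ := v) (by simp)]
    have hs : 0 < a ^ 2 + b ^ 2 := by
      rcases hab with h | h <;> positivity
    have key : ∀ q : ℝ × ℝ, a * q.1 + b * q.2 = a * v.1 + b * v.2 →
        ∃ r : ℝ, q = r • ((-b, a) : ℝ × ℝ) +ᵥ v := fun q hq => by
      refine ⟨(a * (q.2 - v.2) - b * (q.1 - v.1)) / (a ^ 2 + b ^ 2), ?_⟩
      ext
      · simp only [vadd_eq_add, Prod.fst_add, Prod.smul_fst, smul_eq_mul]
        field_simp
        linear_combination a * hq
      · simp only [vadd_eq_add, Prod.snd_add, Prod.smul_snd, smul_eq_mul]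
        field_simp
        linear_combination b * hq
    refine ⟨(-b, a), fun q hq => ?_⟩
    simp only [Set.mem_insert_iff, Set.mem_singleton_iff] at hq
    rcases hq with rfl | rfl | rfl
    exacts [key _ rfl, key _ hw, key _ hp]
  rcases hcol.wbtw_or_wbtw_or_wbtw with h | h | h
  · exact Or.inr (Or.inl (mem_segment_iff_wbtw.2 h))
  · exact Or.inl (segment_symm ℝ w v ▸ mem_segment_iff_wbtw.2 h)
  · exact Or.inr (Or.inr (mem_segment_iff_wbtw.2 h))

/-- If the digit `c` uniquely maximizes a linear form, the maximum over the closed convex hull of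
the carpet is attained only at the point with constant digit `c`. -/
theorem eq_of_unique_max_digit {n : ℕ} {Λ : Finset (ℕ × ℕ)} (hn : 2 ≤ n)
    (hΛ : Λ ⊆ Finset.range n ×ˢ Finset.range n) {d : ℕ → ℕ × ℕ} {c : ℕ × ℕ} (hc : c ∈ Λ)
    (hd : ∀ k, d k = c) {v : ℝ × ℝ}
    (h1 : v.1 = ∑' k : ℕ, ((d k).1 : ℝ) / (n : ℝ) ^ (k + 1))
    (h2 : v.2 = ∑' k : ℕ, ((d k).2 : ℝ) / (n : ℝ) ^ (k + 1)) {a b : ℝ}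
    (hmax : ∀ x ∈ Λ, x ≠ c → a * x.1 + b * x.2 < a * c.1 + b * c.2) {w : ℝ × ℝ}
    (hw : w ∈ closure (convexHull ℝ (BMCarpet n n Λ)))
    (hwv : a * w.1 + b * w.2 = a * v.1 + b * v.2) : w = v := by
  have hlt : ∀ x ∈ Λ, (x.1 : ℝ) ≤ n ∧ (x.2 : ℝ) ≤ n := fun x hx => by
    have : x.1 < n ∧ x.2 < n := by simpa using hΛ hx
    exact ⟨by exact_mod_cast this.1.le, by exact_mod_cast this.2.le⟩
  obtain ⟨C, hC⟩ := Finset.exists_le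
    (Λ.image fun x => (n : ℝ) / (a * c.1 + b * c.2 - (a * x.1 + b * x.2)))
  have hC' : ∀ x ∈ Λ, x ≠ c → (n : ℝ) ≤ C * (a * c.1 + b * c.2 - (a * x.1 + b * x.2)) :=
    fun x hx hxc => by
      have := hC _ (Finset.mem_image_of_mem _ hx)
      rwa [div_le_iff₀ (sub_pos.2 (hmax x hx hxc))] at this
  have key : ∀ s t : ℝ, (∀ x ∈ Λ, s * x.1 + t * x.2 - (s * c.1 + t * c.2) ≤ n) →
      s * w.1 + t * w.2 ≤ s * v.1 + t * v.2 := fun s t hst => by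
    have := closure_convexHull_subset_halfplane
      (linear_le_of_digits_le hn hΛ (fun k => (hd k).symm ▸ hc) h1 h2
        (α := s + C * a) (β := t + C * b) fun k x hx => ?_) w hw
    · linear_combination this - C * hwv
    · rw [hd k]
      by_cases hxc : x = c
      · rw [hxc]
      · linarith [hst x hx, hC' x hx hxc]
  have hc0 : (0 : ℝ) ≤ c.1 ∧ (0 : ℝ) ≤ c.2 := ⟨by positivity, by positivity⟩
  have hx0 : ∀ x : ℕ × ℕ, (0 : ℝ) ≤ x.1 ∧ (0 : ℝ) ≤ x.2 := fun x => ⟨by positivity, by positivity⟩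
  ext
  · linarith [key 1 0 fun x hx => by linarith [(hlt x hx).1],
      key (-1) 0 fun x hx => by linarith [(hlt c hc).1, (hx0 x).1]]
  · linarith [key 0 1 fun x hx => by linarith [(hlt x hx).2],
      key 0 (-1) fun x hx => by linarith [(hlt c hc).2, (hx0 x).2]]

theorem tendsto_add_div_pow {n : ℕ} (hn : 2 ≤ n) (x : ℝ) {u : ℕ → ℝ} (hu : ∀ k, |u k| ≤ n) :
    Filter.Tendsto (fun k => x + u k / (n : ℝ) ^ (k + 1)) Filter.atTop (nhds x) := by
  have hn0 : (0 : ℝ) < n := by positivity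
  have hg : Filter.Tendsto (fun k : ℕ => ((1 : ℝ) / n) ^ k) Filter.atTop (nhds 0) :=
    tendsto_pow_atTop_nhds_zero_of_lt_one (by positivity) (by
      rw [div_lt_one hn0]
      exact_mod_cast hn)
  have : Filter.Tendsto (fun k => u k / (n : ℝ) ^ (k + 1)) Filter.atTop (nhds 0) := by
    refine squeeze_zero_norm (fun k => ?_) hg
    rw [Real.norm_eq_abs, abs_div, abs_of_pos (by positivity : (0 : ℝ) < (n : ℝ) ^ (k + 1)), div_pow,
      one_pow, pow_succ, div_le_div_iff₀ (by positivity) (by positivity), one_mul, mul_comm]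
    exact mul_le_mul_of_nonneg_left (hu k) (by positivity)
  simpa using this.const_add x

theorem vertex_accumulation_along_edge
    (n : ℕ) (Λ : Finset (ℕ × ℕ))
    (hn : 2 ≤ n)
    (hΛsub : Λ ⊆ Finset.range n ×ˢ Finset.range n)
    (hΛ1 : 1 < Λ.card) (hΛ2 : Λ.card < n * n)
    (hssc : StrongSep n Λ)
    (hline : ¬ OnALine (BMCarpet n n Λ))
    (v : ℝ × ℝ) (hv : v ∈ (convexHull ℝ (BMCarpet n n Λ)).extremePoints ℝ)
    (e : Set (ℝ × ℝ)) (he : IsEdge (convexHull ℝ (BMCarpet n n Λ)) e)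
    (hve : ∃ w : ℝ × ℝ, e = segment ℝ v w) :
    ∃ seq : ℕ → ℝ × ℝ,
      (∀ k, seq k ∈ (BMCarpet n n Λ ∩ e) \ {v}) ∧
      Filter.Tendsto seq Filter.atTop (nhds v) := by
  obtain ⟨w, rfl⟩ := hve
  obtain ⟨⟨a₀, b₀, hab₀, hseg⟩, hfr, hemax⟩ := he
  have hvw : w ≠ v := by
    rintro rfl
    rw [segment_same] at hseg
    have ha := hseg ▸ left_mem_segment ℝ a₀ b₀
    have hb := hseg ▸ right_mem_segment ℝ a₀ b₀
    exact hab₀ (ha.trans hb.symm)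
  have hvcl := (hfr (left_mem_segment ℝ v w)).1
  have hwcl := (hfr (right_mem_segment ℝ v w)).1
  obtain ⟨a, b, hab, hint, hcl⟩ :=
    exists_supporting_line hline (hfr (midpoint_mem_segment (𝕜 := ℝ) v w))
  have hmid : 2 * (a * (midpoint ℝ v w).1 + b * (midpoint ℝ v w).2)
      = (a * v.1 + b * v.2) + (a * w.1 + b * w.2) := by
    rw [midpoint_eq_smul_add]
    simp only [Prod.smul_fst, Prod.smul_snd, Prod.fst_add, Prod.snd_add, smul_eq_mul, invOf_eq_inv]
    ring
  have hvM : a * (midpoint ℝ v w).1 + b * (midpoint ℝ v w).2 = a * v.1 + b * v.2 := by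
    linarith [hcl v hvcl, hcl w hwcl]
  have hwM : a * w.1 + b * w.2 = a * v.1 + b * v.2 := by
    linarith [hcl v hvcl, hcl w hwcl]
  rw [hvM] at hint hcl
  have hfront : ∀ p q : ℝ × ℝ, p ∈ closure (convexHull ℝ (BMCarpet n n Λ)) →
      q ∈ closure (convexHull ℝ (BMCarpet n n Λ)) →
      a * p.1 + b * p.2 = a * v.1 + b * v.2 → a * q.1 + b * q.2 = a * v.1 + b * v.2 →
      segment ℝ p q ⊆ frontier (convexHull ℝ (BMCarpet n n Λ)) := by
    intro p q hp hq hpM hqM x hx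
    refine ⟨(convex_convexHull ℝ _).closure.segment_subset hp hq hx, fun hxi => ?_⟩
    refine (hint x hxi).ne ?_
    obtain ⟨s, t, -, -, hst, rfl⟩ := hx
    simp only [Prod.smul_fst, Prod.smul_snd, Prod.fst_add, Prod.snd_add, smul_eq_mul]
    linear_combination s * hpM + t * hqM + (a * v.1 + b * v.2) * hst
  have hKcl : ∀ p ∈ BMCarpet n n Λ, p ∈ closure (convexHull ℝ (BMCarpet n n Λ)) := fun p hp =>
    subset_closure (subset_convexHull ℝ _ hp)
  have hface : ∀ p ∈ BMCarpet n n Λ, a * p.1 + b * p.2 = a * v.1 + b * v.2 →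
      p ∈ segment ℝ v w := by
    intro p hp hpM
    have hpcl := hKcl p hp
    rcases mem_segment_trichotomy_of_line hab hwM hpM with h | h | h
    · exact h
    · rw [← hemax v p ((convex_segment v p).segment_subset (left_mem_segment ℝ v p) h)
        (hfront v p hvcl hpcl rfl hpM)]
      exact right_mem_segment ℝ v p
    · rw [← hemax p w ((convex_segment p w).segment_subset h (right_mem_segment ℝ p w))
        (hfront p w hpcl hwcl hpM hwM)]
      exact left_mem_segment ℝ p w
  obtain ⟨d, hd, h1, h2⟩ := extremePoints_convexHull_subset hv
  have hn0 : (0 : ℝ) < n := by positivity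
  have hdmax : ∀ k, ∀ x ∈ Λ, a * x.1 + b * x.2 ≤ a * (d k).1 + b * (d k).2 := by
    intro k x hx
    have := hcl _ (hKcl _ (digit_change_mem hn hΛsub hd h1 h2 k hx))
    have hpos : (0 : ℝ) < (n : ℝ) ^ (k + 1) := by positivity
    have h3 : ((a * x.1 + b * x.2) - (a * (d k).1 + b * (d k).2)) / (n : ℝ) ^ (k + 1) ≤ 0 := by
      simp only at this
      calc _ = a * (((x.1 : ℝ) - (d k).1) / (n : ℝ) ^ (k + 1))
            + b * (((x.2 : ℝ) - (d k).2) / (n : ℝ) ^ (k + 1)) := by ring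
        _ ≤ 0 := by linarith
    rw [div_le_iff₀ hpos, zero_mul] at h3
    linarith
  have hother : ∀ k, ∃ x ∈ Λ, x ≠ d k ∧ a * x.1 + b * x.2 = a * (d k).1 + b * (d k).2 := by
    intro k
    by_contra! hk
    refine hvw (eq_of_unique_max_digit hn hΛsub (hd k) (fun j => ?_) h1 h2
      (fun x hx hxc => lt_of_le_of_ne (hdmax k x hx) (hk x hx hxc)) hwcl hwM)
    by_contra hj
    exact hk (d j) (hd j) hj (le_antisymm (hdmax k _ (hd j)) (hdmax j _ (hd k)))
  choose x hxΛ hxne hxM using hother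
  have hlt : ∀ y ∈ Λ, (y.1 : ℝ) ≤ n ∧ (y.2 : ℝ) ≤ n := fun y hy => by
    have : y.1 < n ∧ y.2 < n := by simpa using hΛsub hy
    exact ⟨by exact_mod_cast this.1.le, by exact_mod_cast this.2.le⟩
  refine ⟨fun k => (v.1 + (((x k).1 : ℝ) - (d k).1) / (n : ℝ) ^ (k + 1),
      v.2 + (((x k).2 : ℝ) - (d k).2) / (n : ℝ) ^ (k + 1)), fun k => ?_, ?_⟩
  · have hmem := digit_change_mem hn hΛsub hd h1 h2 k (hxΛ k)
    refine ⟨⟨hmem, hface _ hmem ?_⟩, fun heq => hxne k ?_⟩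
    · linear_combination (1 / (n : ℝ) ^ (k + 1)) * hxM k
    · have hpos : (n : ℝ) ^ (k + 1) ≠ 0 := by positivity
      have e1 := congrArg Prod.fst (Set.mem_singleton_iff.1 heq)
      have e2 := congrArg Prod.snd (Set.mem_singleton_iff.1 heq)
      simp only [add_eq_left, div_eq_zero_iff, hpos, or_false, sub_eq_zero, Nat.cast_inj] at e1 e2
      exact Prod.ext e1 e2
  · have habs : ∀ s t : ℝ, 0 ≤ s → 0 ≤ t → s ≤ n → t ≤ n → |s - t| ≤ n := fun s t _ _ _ _ =>
      abs_le.2 ⟨by linarith, by linarith⟩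
    rw [nhds_prod_eq]
    exact (tendsto_add_div_pow hn v.1 fun k => habs _ _ (by positivity) (by positivity)
        (hlt _ (hxΛ k)).1 (hlt _ (hd k)).1).prodMk
      (tendsto_add_div_pow hn v.2 fun k => habs _ _ (by positivity) (by positivity)
        (hlt _ (hxΛ k)).2 (hlt _ (hd k)).2)
end

section
/- Let K = K(n,Λ) be a generalized Sierpiński carpet satisfying the strong separation condition and not contained in any affine line of ℝ², let P be the convex hull of K, and let f be a similitude on ℝ² with positive similarity ratio such that f(K) ⊆ K. Then for every extreme point v of P and every edge e of P having v as an endpoint, there exist nonempty finite words u and w over Λ, an extreme point v' of P, and an edge e' of P such that f(φ_w(v')) = φ_u(v) and f(φ_w(e')) ⊆ φ_u(e). -/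
open scoped BigOperators

/-- `φ_u = φ_{u 0} ∘ φ_{u 1} ∘ ⋯` for a finite word `u` over `Λ`. -/
noncomputable def sierpWordMap (n : ℕ) (u : List (ℕ × ℕ)) : ℝ × ℝ → ℝ × ℝ :=
  u.foldr (fun ij g => sierpMap n ij ∘ g) id

/-- The integer translation part of `sierpWordMap n u`, rescaled by `n ^ u.length`. -/
def wordShift (n : ℕ) : List (ℕ × ℕ) → ℕ × ℕ
  | [] => 0
  | a :: u => wordShift n u + n ^ u.length • a

/-- The words of length `m` over `Λ`. -/
def wordsOfLength (Λ : Finset (ℕ × ℕ)) (m : ℕ) : Finset (List (ℕ × ℕ)) :=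
  (Fintype.piFinset fun _ : Fin m => Λ).image List.ofFn

theorem mem_wordsOfLength {Λ : Finset (ℕ × ℕ)} {m : ℕ} {u : List (ℕ × ℕ)} :
    u ∈ wordsOfLength Λ m ↔ u.length = m ∧ ∀ x ∈ u, x ∈ Λ := by
  simp only [wordsOfLength, Finset.mem_image, Fintype.mem_piFinset]
  constructor
  · rintro ⟨d, hd, rfl⟩
    refine ⟨List.length_ofFn, fun x hx => ?_⟩
    obtain ⟨i, rfl⟩ := (List.mem_ofFn' d x).1 hx
    exact hd i
  · rintro ⟨rfl, hu⟩
    exact ⟨u.get, fun i => hu _ (u.get_mem i), List.ofFn_get u⟩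

theorem card_wordsOfLength (Λ : Finset (ℕ × ℕ)) (m : ℕ) :
    (wordsOfLength Λ m).card = Λ.card ^ m := by
  rw [wordsOfLength, Finset.card_image_of_injective _ List.ofFn_injective]
  simp

theorem sierpWordMap_append (n : ℕ) (u v : List (ℕ × ℕ)) (x : ℝ × ℝ) :
    sierpWordMap n (u ++ v) x = sierpWordMap n u (sierpWordMap n v x) := by
  induction u with
  | nil => rfl
  | cons a u ih => simpa [sierpWordMap] using congrArg (sierpMap n a) ih

theorem sierpWordMap_cons (n : ℕ) (a : ℕ × ℕ) (u : List (ℕ × ℕ)) (x : ℝ × ℝ) :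
    sierpWordMap n (a :: u) x = sierpMap n a (sierpWordMap n u x) := rfl

theorem sierpWordMap_eq {n : ℕ} (hn : n ≠ 0) (u : List (ℕ × ℕ)) (x : ℝ × ℝ) :
    sierpWordMap n u x = ((n : ℝ) ^ u.length)⁻¹ •
      (x + (((wordShift n u).1 : ℝ), ((wordShift n u).2 : ℝ))) := by
  have hn' : (n : ℝ) ≠ 0 := by exact_mod_cast hn
  induction u with
  | nil => ext <;> simp [sierpWordMap, wordShift]
  | cons a u ih =>
    rw [sierpWordMap_cons, ih]
    ext <;> simp [sierpMap, wordShift, pow_succ] <;> field_simp <;> ring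

theorem sierpWordMap_sub {n : ℕ} (hn : n ≠ 0) (u : List (ℕ × ℕ)) (x y : ℝ × ℝ) :
    sierpWordMap n u x - sierpWordMap n u y = ((n : ℝ) ^ u.length)⁻¹ • (x - y) := by
  rw [sierpWordMap_eq hn, sierpWordMap_eq hn, ← smul_sub, add_sub_add_right_eq_sub]

theorem dist_sierpWordMap {n : ℕ} (hn : n ≠ 0) (u : List (ℕ × ℕ)) (x y : ℝ × ℝ) :
    dist (sierpWordMap n u x) (sierpWordMap n u y) = ((n : ℝ) ^ u.length)⁻¹ * dist x y := by
  rw [dist_eq_norm, sierpWordMap_sub hn, norm_smul, ← dist_eq_norm, Real.norm_of_nonneg (by positivity)]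

theorem sierpWordMap_injective {n : ℕ} (hn : n ≠ 0) (u : List (ℕ × ℕ)) :
    Function.Injective (sierpWordMap n u) := by
  intro x y hxy
  have h := dist_sierpWordMap hn u x y
  rw [hxy, dist_self, zero_eq_mul] at h
  have hn' : (n : ℝ) ≠ 0 := by exact_mod_cast hn
  exact dist_eq_zero.1 (h.resolve_left (by positivity))

/-- A nonempty compact set which is the union of its pairwise disjoint images under the maps
`sierpMap n a`, `a ∈ Λ`. -/
structure IsSeparatedAttractor (n : ℕ) (Λ : Finset (ℕ × ℕ)) (K : Set (ℝ × ℝ)) : Prop where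
  two_le : 2 ≤ n
  isCompact : IsCompact K
  nonempty : K.Nonempty
  map_mem : ∀ a ∈ Λ, ∀ x ∈ K, sierpMap n a x ∈ K
  exists_map_eq : ∀ x ∈ K, ∃ a ∈ Λ, ∃ y ∈ K, sierpMap n a y = x
  disjoint : ∀ a ∈ Λ, ∀ b ∈ Λ, a ≠ b → Disjoint (sierpMap n a '' K) (sierpMap n b '' K)

namespace IsSeparatedAttractor

variable {n : ℕ} {Λ : Finset (ℕ × ℕ)} {K : Set (ℝ × ℝ)}

theorem ne_zero (h : IsSeparatedAttractor n Λ K) : n ≠ 0 := by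
  have := h.two_le
  omega

theorem one_lt (h : IsSeparatedAttractor n Λ K) : (1 : ℝ) < n := by
  exact_mod_cast h.two_le

theorem pos (h : IsSeparatedAttractor n Λ K) : (0 : ℝ) < n :=
  zero_lt_one.trans h.one_lt

theorem wordMap_mem (h : IsSeparatedAttractor n Λ K) {u : List (ℕ × ℕ)} (hu : ∀ x ∈ u, x ∈ Λ)
    {x : ℝ × ℝ} (hx : x ∈ K) : sierpWordMap n u x ∈ K := by
  induction u with
  | nil => exact hx
  | cons a u ih =>
    simp only [List.mem_cons, forall_eq_or_imp] at hu
    exact h.map_mem a hu.1 _ (ih hu.2)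

theorem exists_wordMap_eq (h : IsSeparatedAttractor n Λ K) (m : ℕ) {x : ℝ × ℝ} (hx : x ∈ K) :
    ∃ u ∈ wordsOfLength Λ m, ∃ y ∈ K, sierpWordMap n u y = x := by
  induction m generalizing x with
  | zero => exact ⟨[], by simp [mem_wordsOfLength], x, hx, rfl⟩
  | succ m ih =>
    obtain ⟨a, ha, y, hy, rfl⟩ := h.exists_map_eq x hx
    obtain ⟨u, hu, z, hz, rfl⟩ := ih hy
    rw [mem_wordsOfLength] at hu
    refine ⟨a :: u, mem_wordsOfLength.2 ⟨by simp [hu.1], ?_⟩, z, hz, rfl⟩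
    simpa [ha] using hu.2

theorem exists_separation (h : IsSeparatedAttractor n Λ K) :
    ∃ δ > 0, ∀ a ∈ Λ, ∀ b ∈ Λ, a ≠ b → ∀ x ∈ K, ∀ y ∈ K,
      δ ≤ dist (sierpMap n a x) (sierpMap n b y) := by
  have hcont : ∀ a, Continuous (sierpMap n a) := fun a => by
    unfold sierpMap
    fun_prop
  let S : Set ((ℝ × ℝ) × (ℝ × ℝ)) := ⋃ p ∈ Λ.offDiag, (sierpMap n p.1 '' K) ×ˢ (sierpMap n p.2 '' K)
  have hS : IsCompact S := Λ.offDiag.isCompact_biUnion fun p _ =>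
    (h.isCompact.image (hcont p.1)).prod (h.isCompact.image (hcont p.2))
  obtain ⟨δ, hδ, hle⟩ := hS.exists_forall_le' (f := fun q => dist q.1 q.2) (a := 0)
    continuous_dist.continuousOn (by
      simp only [S, Set.mem_iUnion]
      rintro q ⟨p, hp, h1, h2⟩
      rw [Finset.mem_offDiag] at hp
      exact dist_pos.2 ((h.disjoint p.1 hp.1 p.2 hp.2.1 hp.2.2).ne_of_mem h1 h2))
  refine ⟨δ, hδ, fun a ha b hb hab x hx y hy => hle (_, _) ?_⟩
  simp only [S, Set.mem_iUnion]
  exact ⟨(a, b), Finset.mem_offDiag.2 ⟨ha, hb, hab⟩, ⟨x, hx, rfl⟩, ⟨y, hy, rfl⟩⟩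

theorem exists_word_separation (h : IsSeparatedAttractor n Λ K) :
    ∃ δ > 0, ∀ m, ∀ u ∈ wordsOfLength Λ m, ∀ v ∈ wordsOfLength Λ m, ∀ x ∈ K, ∀ y ∈ K,
      dist (sierpWordMap n u x) (sierpWordMap n v y) < ((n : ℝ) ^ m)⁻¹ * δ → u = v := by
  obtain ⟨δ, hδ, hsep⟩ := h.exists_separation
  have hn := h.pos
  refine ⟨δ, hδ, fun m => ?_⟩
  induction m with
  | zero =>
    intro u hu v hv x hx y hy _
    rw [mem_wordsOfLength, List.length_eq_zero_iff] at hu hv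
    rw [hu.1, hv.1]
  | succ m ih =>
    intro u hu v hv x hx y hy hd
    rw [mem_wordsOfLength] at hu hv
    match u, v, hu, hv with
    | a :: u, b :: v, hu, hv =>
      simp only [List.length_cons, Nat.add_right_cancel_iff, List.mem_cons,
        forall_eq_or_imp] at hu hv
      rw [sierpWordMap_cons, sierpWordMap_cons] at hd
      obtain rfl : a = b := by
        by_contra hab
        refine (hsep a hu.2.1 b hv.2.1 hab _ (h.wordMap_mem hu.2.2 hx) _
          (h.wordMap_mem hv.2.2 hy)).not_gt (hd.trans_le ?_)
        exact mul_le_of_le_one_left hδ.le (inv_le_one_of_one_le₀ (one_le_pow₀ h.one_lt.le))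
      rw [ih u (mem_wordsOfLength.2 ⟨hu.1, hu.2.2⟩) v (mem_wordsOfLength.2 ⟨hv.1, hv.2.2⟩) x hx y hy]
      have hs : dist (sierpMap n a (sierpWordMap n u x)) (sierpMap n a (sierpWordMap n v y)) =
          ((n : ℝ) ^ [a].length)⁻¹ * dist (sierpWordMap n u x) (sierpWordMap n v y) :=
        dist_sierpWordMap h.ne_zero [a] _ _
      rw [hs, List.length_singleton, pow_one, pow_succ', mul_inv, mul_assoc,
        mul_lt_mul_iff_right₀ (by positivity)] at hd
      exact hd

theorem wordShift_injOn (h : IsSeparatedAttractor n Λ K) (m : ℕ) :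
    Set.InjOn (wordShift n) (wordsOfLength Λ m : Set (List (ℕ × ℕ))) := by
  obtain ⟨δ, hδ, hsep⟩ := h.exists_word_separation
  obtain ⟨x, hx⟩ := h.nonempty
  have hn := h.pos
  intro u hu v hv huv
  refine hsep m u hu v hv x hx x hx ?_
  rw [sierpWordMap_eq h.ne_zero, sierpWordMap_eq h.ne_zero, huv,
    (mem_wordsOfLength.1 hu).1, (mem_wordsOfLength.1 hv).1, dist_self]
  positivity

/-- A bounded cluster of words of a fixed length has uniformly bounded cardinality. -/
theorem exists_card_le (h : IsSeparatedAttractor n Λ K) (R : ℝ) :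
    ∃ C : ℕ, 0 < C ∧ ∀ m, ∀ S ⊆ wordsOfLength Λ m, ∀ x : ℝ × ℝ,
      (∀ u ∈ S, ∀ v ∈ S, dist (sierpWordMap n u x) (sierpWordMap n v x) ≤ ((n : ℝ) ^ m)⁻¹ * R) →
      S.card ≤ C := by
  let r : ℤ := ⌈R⌉
  refine ⟨(Finset.Icc ((-r, -r) : ℤ × ℤ) (r, r)).card + 1, by omega, fun m S hS x hR => ?_⟩
  obtain rfl | ⟨v, hv⟩ := S.eq_empty_or_nonempty
  · simp
  have hn := h.pos
  refine le_trans (Finset.card_le_card_of_injOn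
    (fun u => (((wordShift n u).1 : ℤ) - (wordShift n v).1,
      ((wordShift n u).2 : ℤ) - (wordShift n v).2)) (fun u hu => ?_) ?_) (Nat.le_succ _)
  · have hd := hR u hu v hv
    rw [sierpWordMap_eq h.ne_zero, sierpWordMap_eq h.ne_zero, (mem_wordsOfLength.1 (hS hu)).1,
      (mem_wordsOfLength.1 (hS hv)).1, dist_smul₀, Real.norm_of_nonneg (by positivity),
      mul_le_mul_iff_right₀ (by positivity), dist_add_left, Prod.dist_eq, max_le_iff,
      Real.dist_eq, Real.dist_eq, abs_le, abs_le] at hd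
    have hr : R ≤ r := Int.le_ceil R
    simp only [Finset.coe_Icc, Set.mem_Icc, Prod.mk_le_mk]
    obtain ⟨⟨h1, h2⟩, h3, h4⟩ := hd
    refine ⟨⟨?_, ?_⟩, ?_, ?_⟩ <;> rify <;> linarith
  · intro u hu u' hu' huu
    simp only [Prod.mk.injEq] at huu
    refine h.wordShift_injOn m (hS hu) (hS hu') (Prod.ext ?_ ?_) <;> omega

theorem exists_card_le_of_map (h : IsSeparatedAttractor n Λ K) {A : (ℝ × ℝ) →ₗ[ℝ] (ℝ × ℝ)}
    (hA : Function.Injective A) (b : ℝ × ℝ) (p : ℕ) :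
    ∃ C : ℕ, 0 < C ∧ ∀ m, ∀ u ∈ wordsOfLength Λ m, ∀ S ⊆ wordsOfLength Λ (m + p), ∀ x : ℝ × ℝ,
      (∀ w ∈ S, A (sierpWordMap n w x) + b ∈ sierpWordMap n u '' K) → S.card ≤ C := by
  obtain ⟨c, hc, hAc⟩ := A.exists_antilipschitzWith (LinearMap.ker_eq_bot.2 hA)
  obtain ⟨D, hD⟩ := Metric.isBounded_iff.1 h.isCompact.isBounded
  obtain ⟨C, hC, hcard⟩ := h.exists_card_le ((n : ℝ) ^ p * (c * D))
  have hn := h.pos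
  refine ⟨C, hC, fun m u hu S hS x hx => hcard _ S hS x fun w hw w' hw' => ?_⟩
  obtain ⟨y, hy, hyw⟩ := hx w hw
  obtain ⟨y', hy', hyw'⟩ := hx w' hw'
  calc dist (sierpWordMap n w x) (sierpWordMap n w' x)
      ≤ c * dist (A (sierpWordMap n w x)) (A (sierpWordMap n w' x)) := hAc.le_mul_dist _ _
    _ = c * (((n : ℝ) ^ m)⁻¹ * dist y y') := by
        rw [← dist_add_right _ _ b, ← hyw, ← hyw', dist_sierpWordMap h.ne_zero,
          (mem_wordsOfLength.1 hu).1]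
    _ ≤ c * (((n : ℝ) ^ m)⁻¹ * D) := by gcongr; exact hD hy hy'
    _ = ((n : ℝ) ^ (m + p))⁻¹ * ((n : ℝ) ^ p * (c * D)) := by
        rw [pow_add]
        field_simp

theorem wordMap_append_mem (h : IsSeparatedAttractor n Λ K) {u v : List (ℕ × ℕ)}
    (hv : ∀ x ∈ v, x ∈ Λ) {y : ℝ × ℝ} (hy : y ∈ sierpWordMap n (u ++ v) '' K) :
    y ∈ sierpWordMap n u '' K := by
  obtain ⟨x, hx, rfl⟩ := hy
  exact ⟨_, h.wordMap_mem hv hx, (sierpWordMap_append n u v x).symm⟩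

theorem card_pos (h : IsSeparatedAttractor n Λ K) : 0 < Λ.card := by
  obtain ⟨x, hx⟩ := h.nonempty
  obtain ⟨a, ha, -⟩ := h.exists_map_eq x hx
  exact Finset.card_pos.2 ⟨a, ha⟩

/-- The image of `K` under an injective affine self-map meets every subcylinder of relative depth
`k` of some cylinder. -/
theorem exists_word_forall_meet (h : IsSeparatedAttractor n Λ K)
    {A : (ℝ × ℝ) →ₗ[ℝ] (ℝ × ℝ)} (hA : Function.Injective A) {b : ℝ × ℝ}
    (hK : ∀ x ∈ K, A x + b ∈ K) (k : ℕ) :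
    ∃ u : List (ℕ × ℕ), (∀ x ∈ u, x ∈ Λ) ∧
      ∀ v ∈ wordsOfLength Λ k, ∃ x ∈ K, A x + b ∈ sierpWordMap n (u ++ v) '' K := by
  classical
  by_contra! hcon
  choose! V hV hVmiss using hcon
  let Y : ℕ → Finset (List (ℕ × ℕ)) := fun m =>
    (wordsOfLength Λ m).filter fun u => ∃ x ∈ K, A x + b ∈ sierpWordMap n u '' K
  have hY : ∀ j, (Y (j * k)).card ≤ (Λ.card ^ k - 1) ^ j := by
    intro j
    induction j with
    | zero =>
      refine (Finset.card_filter_le _ _).trans ?_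
      simp [card_wordsOfLength]
    | succ j ih =>
      have hsub : Y ((j + 1) * k) ⊆ (Y (j * k)).biUnion fun u =>
          ((wordsOfLength Λ k).erase (V u)).image (u ++ ·) := by
        intro w hw
        obtain ⟨hw, x, hx, hxw⟩ := Finset.mem_filter.1 hw
        obtain ⟨hlen, hmem⟩ := mem_wordsOfLength.1 hw
        have hlen' : w.length = j * k + k := by rw [hlen]; ring
        have hu : ∀ a ∈ w.take (j * k), a ∈ Λ := fun a ha => hmem a (List.mem_of_mem_take ha)
        have hv : ∀ a ∈ w.drop (j * k), a ∈ Λ := fun a ha => hmem a (List.mem_of_mem_drop ha)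
        rw [← List.take_append_drop (j * k) w] at hxw
        refine Finset.mem_biUnion.2 ⟨w.take (j * k), Finset.mem_filter.2
          ⟨mem_wordsOfLength.2 ⟨by simp [hlen'], hu⟩, x, hx, h.wordMap_append_mem hv hxw⟩,
          Finset.mem_image.2 ⟨w.drop (j * k), Finset.mem_erase.2
            ⟨fun heq => ?_, mem_wordsOfLength.2 ⟨by simp [hlen'], hv⟩⟩,
            List.take_append_drop _ _⟩⟩
        rw [heq] at hxw
        exact hVmiss _ hu x hx hxw
      refine (Finset.card_le_card hsub).trans ((Finset.card_biUnion_le_card_mul _ _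
        (Λ.card ^ k - 1) fun u hu => ?_).trans ?_)
      · refine Finset.card_image_le.trans ?_
        rw [Finset.card_erase_of_mem (hV u (mem_wordsOfLength.1 (Finset.mem_filter.1 hu).1).2),
          card_wordsOfLength]
      · rw [pow_succ]
        gcongr
  obtain ⟨C, hC, hcard⟩ := h.exists_card_le_of_map hA b 0
  obtain ⟨x, hx⟩ := h.nonempty
  have hlow : ∀ m, Λ.card ^ m ≤ C * (Y m).card := by
    intro m
    rw [← card_wordsOfLength]
    have hex : ∀ w ∈ wordsOfLength Λ m, ∃ u ∈ wordsOfLength Λ m,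
        A (sierpWordMap n w x) + b ∈ sierpWordMap n u '' K := fun w hw => by
      obtain ⟨u, hu, y, hy, hyu⟩ :=
        h.exists_wordMap_eq m (hK _ (h.wordMap_mem (mem_wordsOfLength.1 hw).2 hx))
      exact ⟨u, hu, y, hy, hyu⟩
    choose! U hU hUmem using hex
    refine Finset.card_le_mul_card_image_of_maps_to (f := U) (fun w hw => ?_) C fun u hu => ?_
    · exact Finset.mem_filter.2 ⟨hU w hw, _, h.wordMap_mem (mem_wordsOfLength.1 hw).2 hx,
        hUmem w hw⟩
    · refine hcard m u (Finset.mem_filter.1 hu).1 _ (Finset.filter_subset _ _) x fun w hw => ?_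
      rw [Finset.mem_filter] at hw
      exact hw.2 ▸ hUmem w hw.1
  have ha : 0 < Λ.card ^ k := pow_pos h.card_pos k
  set a := Λ.card ^ k
  have ha' : (0 : ℝ) < a := by exact_mod_cast ha
  obtain ⟨j, hj⟩ := exists_pow_lt_of_lt_one (x := (C : ℝ)⁻¹) (y := ((a - 1 : ℕ) : ℝ) / a)
    (by positivity) (by
      rw [div_lt_one ha']
      exact_mod_cast Nat.sub_lt ha one_pos)
  have hle : a ^ j ≤ C * (a - 1) ^ j := by
    calc a ^ j = Λ.card ^ (j * k) := by rw [mul_comm, pow_mul]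
      _ ≤ _ := (hlow _).trans (Nat.mul_le_mul_left _ (hY j))
  have hle' : (a : ℝ) ^ j ≤ C * ((a - 1 : ℕ) : ℝ) ^ j := by exact_mod_cast hle
  have hC' : (0 : ℝ) < C := by exact_mod_cast hC
  rw [div_pow, div_lt_iff₀ (by positivity), ← div_eq_inv_mul, lt_div_iff₀ hC'] at hj
  linarith

theorem eventually_dist_wordMap_lt (h : IsSeparatedAttractor n Λ K) {ε : ℝ} (hε : 0 < ε) :
    ∀ᶠ m in Filter.atTop, ∀ u ∈ wordsOfLength Λ m, ∀ x ∈ K, ∀ y ∈ K,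
      dist (sierpWordMap n u x) (sierpWordMap n u y) < ε := by
  obtain ⟨D, hD⟩ := Metric.isBounded_iff.1 h.isCompact.isBounded
  have hn := h.pos
  have hlim : Filter.Tendsto (fun m : ℕ => ((n : ℝ)⁻¹) ^ m * D) Filter.atTop (nhds (0 * D)) :=
    (tendsto_pow_atTop_nhds_zero_of_lt_one (by positivity)
      (inv_lt_one_of_one_lt₀ h.one_lt)).mul_const D
  rw [zero_mul] at hlim
  filter_upwards [hlim.eventually_lt_const hε] with m hm u hu x hx y hy
  rw [dist_sierpWordMap h.ne_zero, (mem_wordsOfLength.1 hu).1, ← inv_pow]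
  refine lt_of_le_of_lt ?_ hm
  gcongr
  exact hD hx hy

theorem exists_mem_wordMap_image_of_dist_lt (h : IsSeparatedAttractor n Λ K) :
    ∃ δ > 0, ∀ m, ∀ u ∈ wordsOfLength Λ m, ∀ x ∈ K, ∀ y ∈ sierpWordMap n u '' K,
      dist x y < ((n : ℝ) ^ m)⁻¹ * δ → x ∈ sierpWordMap n u '' K := by
  obtain ⟨δ, hδ, hsep⟩ := h.exists_word_separation
  refine ⟨δ, hδ, fun m u hu x hx y hy hd => ?_⟩
  obtain ⟨y, hy, rfl⟩ := hy
  obtain ⟨v, hv, z, hz, rfl⟩ := h.exists_wordMap_eq m hx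
  obtain rfl := hsep m v hv u hu z hz y hy hd
  exact ⟨z, hz, rfl⟩

theorem sierpWordMap_add {n : ℕ} (hn : n ≠ 0) (u : List (ℕ × ℕ)) (x y : ℝ × ℝ) :
    sierpWordMap n u (x + y) = ((n : ℝ) ^ u.length)⁻¹ • x + sierpWordMap n u y := by
  rw [← sub_eq_iff_eq_add, sierpWordMap_sub hn, add_sub_cancel_right]

theorem sierpWordMap_surjective {n : ℕ} (hn : n ≠ 0) (u : List (ℕ × ℕ)) :
    Function.Surjective (sierpWordMap n u) := by
  have hn' : (n : ℝ) ≠ 0 := by exact_mod_cast hn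
  intro y
  refine ⟨((n : ℝ) ^ u.length) • (y - sierpWordMap n u 0) + 0, ?_⟩
  rw [sierpWordMap_add hn, smul_smul, inv_mul_cancel₀ (by positivity), one_smul, sub_add_cancel]

/-- An affine map restricted to a cylinder and rescaled along another cylinder is affine. -/
theorem exists_wordMap_comp_eq {n : ℕ} (hn : n ≠ 0) (A : (ℝ × ℝ) →ₗ[ℝ] (ℝ × ℝ)) (b : ℝ × ℝ)
    (u w : List (ℕ × ℕ)) :
    ∃ t, ∀ x, A (sierpWordMap n w x) + b =
      sierpWordMap n u (((n : ℝ) ^ u.length * ((n : ℝ) ^ w.length)⁻¹) • A x + t) := by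
  have hn' : (n : ℝ) ≠ 0 := by exact_mod_cast hn
  obtain ⟨t, ht⟩ := sierpWordMap_surjective hn u (A (sierpWordMap n w 0) + b)
  refine ⟨t, fun x => ?_⟩
  rw [sierpWordMap_add hn, ht, ← add_zero x, sierpWordMap_add hn, map_add, map_smul, smul_smul,
    inv_mul_cancel_left₀ (by positivity), add_zero, add_assoc]

/-- The translation parts of the self-maps of `K` obtained by restricting `x ↦ A x + b` to a
cylinder and rescaling the image, all of which have the same linear part. -/
def rescaledTranslations (n : ℕ) (Λ : Finset (ℕ × ℕ)) (K : Set (ℝ × ℝ))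
    (A : (ℝ × ℝ) →ₗ[ℝ] (ℝ × ℝ)) (b : ℝ × ℝ) (p : ℕ) : Set (ℝ × ℝ) :=
  {t | (∀ x ∈ K, ((n : ℝ) ^ p)⁻¹ • A x + t ∈ K) ∧ ∃ u w : List (ℕ × ℕ),
    (∀ x ∈ u, x ∈ Λ) ∧ (∀ x ∈ w, x ∈ Λ) ∧
      ∀ x, A (sierpWordMap n w x) + b = sierpWordMap n u (((n : ℝ) ^ p)⁻¹ • A x + t)}

theorem exists_rescaledTranslations (h : IsSeparatedAttractor n Λ K)
    {A : (ℝ × ℝ) →ₗ[ℝ] (ℝ × ℝ)} (hA : Function.Injective A) {b : ℝ × ℝ}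
    (hK : ∀ x ∈ K, A x + b ∈ K) :
    ∃ M p : ℕ, ∀ k, ∃ t : Fin M → ℝ × ℝ, (∀ i, t i ∈ rescaledTranslations n Λ K A b p) ∧
      ∀ v ∈ wordsOfLength Λ k, ∃ i, ∃ x ∈ K,
        ((n : ℝ) ^ p)⁻¹ • A x + t i ∈ sierpWordMap n v '' K := by
  classical
  obtain ⟨δ, hδ, hmem⟩ := h.exists_mem_wordMap_image_of_dist_lt
  have hn := h.pos
  let L := ‖LinearMap.toContinuousLinearMap A‖ + 1
  have hL : 0 < L := by positivity
  have hAL : ∀ x y, dist (A x) (A y) ≤ L * dist x y := fun x y => by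
    rw [dist_eq_norm, dist_eq_norm, ← map_sub]
    refine ((LinearMap.toContinuousLinearMap A).le_opNorm (x - y)).trans ?_
    gcongr
    simp [L]
  obtain ⟨D, hD⟩ := Metric.isBounded_iff.1 h.isCompact.isBounded
  have hD0 : 0 ≤ D := by
    obtain ⟨x, hx⟩ := h.nonempty
    exact dist_nonneg.trans (hD hx hx)
  obtain ⟨p, hp⟩ : ∃ p : ℕ, L * D * ((n : ℝ)⁻¹) ^ p < δ := by
    have hlim := (tendsto_pow_atTop_nhds_zero_of_lt_one (r := (n : ℝ)⁻¹) (by positivity)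
      (inv_lt_one_of_one_lt₀ h.one_lt)).const_mul (L * D)
    rw [mul_zero] at hlim
    exact (hlim.eventually_lt_const hδ).exists
  obtain ⟨M, hM, hcard⟩ := h.exists_card_le_of_map hA b p
  refine ⟨M, p, fun k => ?_⟩
  obtain ⟨u, hu, hmeet⟩ := h.exists_word_forall_meet hA hK k
  have humem : u ∈ wordsOfLength Λ u.length := mem_wordsOfLength.2 ⟨rfl, hu⟩
  let S := (wordsOfLength Λ (u.length + p)).filter fun w =>
    ∀ x ∈ K, A (sierpWordMap n w x) + b ∈ sierpWordMap n u '' K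
  have hSmeet : ∀ v ∈ wordsOfLength Λ k, ∃ w ∈ S, ∃ x ∈ K,
      A (sierpWordMap n w x) + b ∈ sierpWordMap n (u ++ v) '' K := by
    intro v hv
    obtain ⟨x, hx, hxv⟩ := hmeet v hv
    obtain ⟨w, hw, z, hz, rfl⟩ := h.exists_wordMap_eq (u.length + p) hx
    refine ⟨w, Finset.mem_filter.2 ⟨hw, fun y hy => ?_⟩, z, hz, hxv⟩
    refine hmem _ u humem _ (hK _ (h.wordMap_mem (mem_wordsOfLength.1 hw).2 hy)) _
      (h.wordMap_append_mem (mem_wordsOfLength.1 hv).2 hxv) ?_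
    rw [dist_add_right]
    refine (hAL _ _).trans_lt ?_
    rw [dist_sierpWordMap h.ne_zero, (mem_wordsOfLength.1 hw).1]
    calc L * (((n : ℝ) ^ (u.length + p))⁻¹ * dist y z)
        ≤ L * (((n : ℝ) ^ (u.length + p))⁻¹ * D) := by gcongr; exact hD hy hz
      _ = ((n : ℝ) ^ u.length)⁻¹ * (L * D * ((n : ℝ)⁻¹) ^ p) := by
        rw [pow_add, inv_pow, mul_inv]
        ring
      _ < _ := by gcongr
  have hτ : ∀ w ∈ S, ∃ τ ∈ rescaledTranslations n Λ K A b p,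
      ∀ x, A (sierpWordMap n w x) + b = sierpWordMap n u (((n : ℝ) ^ p)⁻¹ • A x + τ) := by
    intro w hw
    obtain ⟨hw, hwK⟩ := Finset.mem_filter.1 hw
    rw [mem_wordsOfLength] at hw
    obtain ⟨τ, heq⟩ := exists_wordMap_comp_eq h.ne_zero A b u w
    rw [hw.1, pow_add, mul_inv, mul_inv_cancel_left₀ (by positivity)] at heq
    refine ⟨τ, ⟨fun x hx => ?_, u, w, hu, hw.2, heq⟩, heq⟩
    obtain ⟨y, hy, hyx⟩ := hwK x hx
    rw [heq] at hyx
    rwa [← sierpWordMap_injective h.ne_zero u hyx]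
  choose! τ hτmem hτeq using hτ
  obtain ⟨x₀, hx₀⟩ := h.nonempty
  have hScard : S.card ≤ M := hcard _ u humem S (Finset.filter_subset _ _) x₀ fun w hw =>
    (Finset.mem_filter.1 hw).2 x₀ hx₀
  obtain ⟨e⟩ := Function.Embedding.nonempty_of_card_le (α := S) (β := Fin M) (by simpa using hScard)
  have hne : Nonempty S := by
    obtain ⟨v, hv⟩ : (wordsOfLength Λ k).Nonempty := by
      rw [← Finset.card_pos, card_wordsOfLength]
      exact pow_pos h.card_pos k
    obtain ⟨w, hw, -⟩ := hSmeet v hv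
    exact ⟨⟨w, hw⟩⟩
  refine ⟨fun i => τ (Function.invFun e i).1, fun i => hτmem _ (Function.invFun e i).2, fun v hv => ?_⟩
  obtain ⟨w, hw, x, hx, y, hy, hyx⟩ := hSmeet v hv
  refine ⟨e ⟨w, hw⟩, x, hx, y, hy, ?_⟩
  dsimp only
  rw [Function.leftInverse_invFun e.injective]
  apply sierpWordMap_injective h.ne_zero u
  rw [← sierpWordMap_append, hyx, hτeq w hw]

theorem eq_zero_of_forall_add_mem {E : Set (ℝ × ℝ)} (hE : Bornology.IsBounded E)
    (hne : E.Nonempty) {s : ℝ × ℝ} (hs : ∀ z ∈ E, z + s ∈ E) : s = 0 := by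
  obtain ⟨z, hz⟩ := hne
  obtain ⟨D, hD⟩ := Metric.isBounded_iff.1 hE
  have hj : ∀ j : ℕ, z + j • s ∈ E := fun j => by
    induction j with
    | zero => simpa
    | succ j ih => rw [succ_nsmul, ← add_assoc]; exact hs _ ih
  by_contra hs0
  obtain ⟨j, hjD⟩ := exists_nat_gt (D / ‖s‖)
  rw [div_lt_iff₀ (norm_pos_iff.2 hs0)] at hjD
  have := hD (hj j) hz
  rw [dist_self_add_left, ← Nat.cast_smul_eq_nsmul ℝ, norm_smul] at this
  simp only [Real.norm_natCast] at this
  linarith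

/-- The image of `K` under an injective affine self-map has nonempty interior in `K`. -/
theorem exists_word_image_subset (h : IsSeparatedAttractor n Λ K)
    {A : (ℝ × ℝ) →ₗ[ℝ] (ℝ × ℝ)} (hA : Function.Injective A) {b : ℝ × ℝ}
    (hK : ∀ x ∈ K, A x + b ∈ K) :
    ∃ u : List (ℕ × ℕ), u ≠ [] ∧ (∀ x ∈ u, x ∈ Λ) ∧
      sierpWordMap n u '' K ⊆ (fun x => A x + b) '' K := by
  obtain ⟨M, p, ht⟩ := h.exists_rescaledTranslations hA hK
  choose t htmem htmeet using ht
  obtain ⟨x₀, hx₀⟩ := h.nonempty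
  have hAc : Continuous A := A.continuous_of_finiteDimensional
  set A' : ℝ × ℝ → ℝ × ℝ := fun x => ((n : ℝ) ^ p)⁻¹ • A x with hA'
  have hA'c : Continuous A' := hAc.const_smul ((n : ℝ) ^ p)⁻¹
  let B : Set (ℝ × ℝ) := {b | ∀ x ∈ K, A' x + b ∈ K}
  have hB : IsCompact B := by
    refine (h.isCompact.image (continuous_id.sub continuous_const)).of_isClosed_subset ?_
      (fun b hb => ⟨A' x₀ + b, hb x₀ hx₀, add_sub_cancel_left (A' x₀) b⟩)
    simp only [B, Set.ofPred_forall]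
    exact isClosed_biInter fun x _ =>
      h.isCompact.isClosed.preimage (continuous_const.add continuous_id)
  obtain ⟨a, -, ψ, hψ, hlim⟩ := (isCompact_univ_pi fun _ : Fin M => hB).tendsto_subseq
    (x := t) (fun k i _ => (htmem k i).1)
  let F : Fin M → Set (ℝ × ℝ) := fun i => (fun x => A' x + a i) '' K
  have hF : ∀ i, IsClosed (F i) := fun i =>
    (h.isCompact.image (hA'c.add continuous_const)).isClosed
  have hcover : K ⊆ ⋃ i, F i := by
    intro y hy
    rw [← (isClosed_iUnion_of_finite hF).closure_eq, Metric.mem_closure_iff]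
    intro ε hε
    obtain ⟨k, hk1, hk2⟩ := ((hψ.tendsto_atTop.eventually
      (h.eventually_dist_wordMap_lt (half_pos hε))).and
        (Metric.tendsto_nhds.1 hlim _ (half_pos hε))).exists
    obtain ⟨v, hv, z, hz, rfl⟩ := h.exists_wordMap_eq (ψ k) hy
    obtain ⟨i, x, hx, z', hz', hzx⟩ := htmeet _ v hv
    refine ⟨A' x + a i, Set.mem_iUnion.2 ⟨i, x, hx, rfl⟩, ?_⟩
    calc dist (sierpWordMap n v z) (A' x + a i)
        ≤ dist (sierpWordMap n v z) (sierpWordMap n v z') +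
            dist (sierpWordMap n v z') (A' x + a i) := dist_triangle _ _ _
      _ < ε / 2 + ε / 2 := by
        refine add_lt_add (hk1 v hv z hz z' hz') ?_
        rw [hzx, dist_add_left]
        exact (dist_le_pi_dist _ _ i).trans_lt hk2
      _ = ε := add_halves ε
  have : CompactSpace K := isCompact_iff_compactSpace.1 h.isCompact
  have : Nonempty K := ⟨⟨x₀, hx₀⟩⟩
  obtain ⟨i, ⟨y, hy⟩, hyi⟩ := nonempty_interior_of_iUnion_of_closed
    (f := fun i => (Subtype.val ⁻¹' F i : Set K))
    (fun i => (hF i).preimage continuous_subtype_val) (by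
      rw [← Set.preimage_iUnion, Set.eq_univ_iff_forall]
      exact fun y => hcover y.2)
  rw [mem_interior_iff_mem_nhds, Metric.mem_nhds_iff] at hyi
  obtain ⟨ε, hε, hball⟩ := hyi
  obtain ⟨q, hq⟩ := (h.eventually_dist_wordMap_lt hε).exists
  obtain ⟨v, hv, y, hy', rfl⟩ := h.exists_wordMap_eq q hy
  have hvmem := (mem_wordsOfLength.1 hv).2
  have hvF : sierpWordMap n v '' K ⊆ F i := by
    rintro _ ⟨z, hz, rfl⟩
    exact hball (a := ⟨_, h.wordMap_mem hvmem hz⟩) (hq v hv z hz y hy')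
  obtain ⟨δ, hδ, hmem⟩ := h.exists_mem_wordMap_image_of_dist_lt
  have hn := h.pos
  obtain ⟨k, hk⟩ := (Metric.tendsto_nhds.1 hlim (((n : ℝ) ^ q)⁻¹ * δ) (by positivity)).exists
  have hti : t (ψ k) i = a i := by
    rw [← sub_eq_zero]
    refine eq_zero_of_forall_add_mem (E := sierpWordMap n v '' K)
      (h.isCompact.isBounded.subset ?_) ⟨_, y, hy', rfl⟩ fun z hz => ?_
    · rintro _ ⟨z, hz, rfl⟩
      exact h.wordMap_mem hvmem hz
    · obtain ⟨x, hx, rfl⟩ := hvF hz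
      have heq : A' x + a i + (t (ψ k) i - a i) = A' x + t (ψ k) i := by abel
      simp only [heq] at hz ⊢
      refine hmem q v hv _ ((htmem (ψ k) i).1 x hx) _ hz ?_
      rw [dist_add_left]
      exact (dist_le_pi_dist _ _ i).trans_lt hk
  obtain ⟨-, u, w, hu, hw, huw⟩ := htmem (ψ k) i
  obtain ⟨c, hc⟩ := Finset.card_pos.1 h.card_pos
  refine ⟨u ++ (v ++ [c]), by simp, ?_, ?_⟩
  · simp only [List.mem_append, List.mem_singleton]
    rintro x (hx | hx | rfl)
    exacts [hu x hx, hvmem x hx, hc]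
  · rintro _ ⟨z, hz, rfl⟩
    obtain ⟨x, hx, hxz⟩ := hvF ⟨_, h.map_mem c hc z hz, rfl⟩
    refine ⟨_, h.wordMap_mem hw hx, ?_⟩
    rw [sierpWordMap_append, sierpWordMap_append]
    simp only [huw, hti]
    exact congrArg _ hxz

end IsSeparatedAttractor

theorem norm_digit_div_pow_le {n : ℕ} (hn : 2 ≤ n) {i : ℕ} (hi : i < n) (k : ℕ) :
    ‖(i : ℝ) / (n : ℝ) ^ (k + 1)‖ ≤ ((n : ℝ)⁻¹) ^ k := by
  have hn' : (0 : ℝ) < n := by positivity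
  rw [Real.norm_of_nonneg (by positivity), inv_pow, div_le_iff₀ (by positivity), pow_succ,
    inv_mul_cancel_left₀ (by positivity)]
  exact_mod_cast hi.le

theorem summable_inv_natCast_pow {n : ℕ} (hn : 2 ≤ n) : Summable fun k : ℕ => ((n : ℝ)⁻¹) ^ k :=
  summable_geometric_of_lt_one (by positivity) (inv_lt_one_of_one_lt₀ (by exact_mod_cast hn))

theorem tsum_digit_div_pow_eq {n : ℕ} (hn : 2 ≤ n) {d : ℕ → ℕ} (hd : ∀ k, d k < n) :
    ∑' k, (d k : ℝ) / (n : ℝ) ^ (k + 1) =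
      (∑' k, (d (k + 1) : ℝ) / (n : ℝ) ^ (k + 1) + d 0) / n := by
  have hsum : Summable fun k => (d k : ℝ) / (n : ℝ) ^ (k + 1) :=
    (summable_inv_natCast_pow hn).of_norm_bounded fun k => norm_digit_div_pow_le hn (hd k) k
  rw [hsum.tsum_eq_zero_add, add_div, ← tsum_div_const, zero_add, pow_one, add_comm]
  simp only [pow_succ, div_div]

theorem digit_lt {n : ℕ} {Λ : Finset (ℕ × ℕ)} (hΛ : Λ ⊆ Finset.range n ×ˢ Finset.range n)
    {a : ℕ × ℕ} (ha : a ∈ Λ) : a.1 < n ∧ a.2 < n := by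
  simpa using hΛ ha

theorem isCompact_bmCarpet {n : ℕ} (hn : 2 ≤ n) {Λ : Finset (ℕ × ℕ)}
    (hΛ : Λ ⊆ Finset.range n ×ˢ Finset.range n) : IsCompact (BMCarpet n n Λ) := by
  let π : (ℕ → Λ) → ℝ × ℝ := fun d =>
    (∑' k, ((d k).1.1 : ℝ) / (n : ℝ) ^ (k + 1), ∑' k, ((d k).1.2 : ℝ) / (n : ℝ) ^ (k + 1))
  have hval : ∀ g : Λ → ℝ, ∀ k, Continuous fun d : ℕ → Λ => g (d k) / (n : ℝ) ^ (k + 1) :=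
    fun g k => (continuous_of_discreteTopology.comp (continuous_apply k)).div_const _
  have hπ : Continuous π := by
    refine Continuous.prodMk ?_ ?_
    · exact continuous_tsum (hval fun a => (a.1.1 : ℝ)) (summable_inv_natCast_pow hn)
        fun k d => norm_digit_div_pow_le hn (digit_lt hΛ (d k).2).1 k
    · exact continuous_tsum (hval fun a => (a.1.2 : ℝ)) (summable_inv_natCast_pow hn)
        fun k d => norm_digit_div_pow_le hn (digit_lt hΛ (d k).2).2 k
  convert isCompact_range hπ
  ext p
  constructor
  · rintro ⟨d, hd, h1, h2⟩
    exact ⟨fun k => ⟨d k, hd k⟩, Prod.ext h1.symm h2.symm⟩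
  · rintro ⟨d, rfl⟩
    exact ⟨fun k => d k, fun k => (d k).2, rfl, rfl⟩

theorem isSeparatedAttractor_bmCarpet {n : ℕ} (hn : 2 ≤ n) {Λ : Finset (ℕ × ℕ)}
    (hΛ : Λ ⊆ Finset.range n ×ˢ Finset.range n) (hne : Λ.Nonempty) (hsep : StrongSep n Λ) :
    IsSeparatedAttractor n Λ (BMCarpet n n Λ) where
  two_le := hn
  isCompact := isCompact_bmCarpet hn hΛ
  nonempty := by
    obtain ⟨a, ha⟩ := hne
    exact ⟨(_, _), fun _ => a, fun _ => ha, rfl, rfl⟩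
  map_mem := by
    rintro a ha p ⟨d, hd, h1, h2⟩
    have hd' : ∀ k, (fun k => Nat.casesOn k a d : ℕ → ℕ × ℕ) k ∈ Λ := by
      rintro (_ | k)
      exacts [ha, hd k]
    refine ⟨fun k => Nat.casesOn k a d, hd', ?_, ?_⟩
    · rw [tsum_digit_div_pow_eq hn fun k => (digit_lt hΛ (hd' k)).1]
      exact congrArg (fun t => (t + (a.1 : ℝ)) / n) h1
    · rw [tsum_digit_div_pow_eq hn fun k => (digit_lt hΛ (hd' k)).2]
      exact congrArg (fun t => (t + (a.2 : ℝ)) / n) h2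
  exists_map_eq := by
    rintro p ⟨d, hd, h1, h2⟩
    refine ⟨d 0, hd 0, (∑' k, ((d (k + 1)).1 : ℝ) / (n : ℝ) ^ (k + 1),
      ∑' k, ((d (k + 1)).2 : ℝ) / (n : ℝ) ^ (k + 1)),
      ⟨fun k => d (k + 1), fun k => hd (k + 1), rfl, rfl⟩, Prod.ext ?_ ?_⟩
    · rw [h1, tsum_digit_div_pow_eq hn fun k => (digit_lt hΛ (hd k)).1, sierpMap]
    · rw [h2, tsum_digit_div_pow_eq hn fun k => (digit_lt hΛ (hd k)).2, sierpMap]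
  disjoint := hsep

/-- A similitude of the plane is an injective affine map. -/
theorem IsSimilitude.exists_linearMap {f : ℝ × ℝ → ℝ × ℝ} {l : ℝ} (hl : 0 < l)
    (hf : IsSimilitude f l) :
    ∃ A : (ℝ × ℝ) →ₗ[ℝ] (ℝ × ℝ), Function.Injective A ∧ ∀ x, f x = A x + f 0 := by
  let E := WithLp.linearEquiv 2 ℝ (ℝ × ℝ)
  let F : WithLp 2 (ℝ × ℝ) → WithLp 2 (ℝ × ℝ) := fun x => l⁻¹ • E.symm (f (E x))
  have hF : Isometry F := by
    refine Isometry.of_dist_eq fun x y => ?_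
    rw [dist_eq_norm, ← smul_sub, norm_smul, ← map_sub, WithLp.prod_norm_eq_of_L2, dist_eq_norm,
      WithLp.prod_norm_eq_of_L2, Real.norm_of_nonneg (by positivity), inv_mul_eq_iff_eq_mul₀ hl.ne']
    simpa [E, sq_abs] using hf (E x) (E y)
  let Φ := hF.affineIsometryOfStrictConvexSpace
  have hΦ : ∀ x, f (E x) = l • E (Φ x) := fun x => by
    simp [Φ, F, smul_smul, hl.ne']
  have hlin : ∀ x, f x = (l • (E.toLinearMap ∘ₗ Φ.linear ∘ₗ E.symm.toLinearMap)) x + f 0 := fun x => by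
    have h1 := hΦ (E.symm x)
    have h2 := hΦ 0
    rw [map_zero] at h2
    rw [LinearEquiv.apply_symm_apply] at h1
    rw [h1, h2]
    have h3 := Φ.toAffineMap.map_vadd 0 (E.symm x)
    simp only [vadd_eq_add, add_zero] at h3
    simp only [AffineIsometry.coe_toAffineMap] at h3
    rw [h3, map_add, smul_add]
    rfl
  refine ⟨_, (injective_iff_map_eq_zero _).2 fun x hx => ?_, hlin⟩
  have h1 := hf x 0
  rw [hlin x, hx, zero_add] at h1
  simp only [sub_self, Prod.fst_zero, Prod.snd_zero, sub_zero] at h1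
  norm_num [hl.ne'] at h1
  rw [Real.sqrt_eq_zero (by positivity)] at h1
  ext
  · exact pow_eq_zero_iff two_ne_zero |>.1 (by nlinarith [sq_nonneg x.1, sq_nonneg x.2])
  · exact pow_eq_zero_iff two_ne_zero |>.1 (by nlinarith [sq_nonneg x.1, sq_nonneg x.2])

theorem convexHull_map_mem {K : Set (ℝ × ℝ)} {A : (ℝ × ℝ) →ₗ[ℝ] (ℝ × ℝ)} {b : ℝ × ℝ}
    (hK : ∀ x ∈ K, A x + b ∈ K) {x : ℝ × ℝ} (hx : x ∈ convexHull ℝ K) :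
    A x + b ∈ convexHull ℝ K :=
  convexHull_min (fun y hy => show A y + b ∈ convexHull ℝ K from subset_convexHull ℝ K (hK y hy))
    ((convex_convexHull ℝ K).affine_preimage (A.toAffineMap + AffineMap.const ℝ (ℝ × ℝ) b)) hx

theorem mem_extremePoints_of_map_mem {P : Set (ℝ × ℝ)} {A : (ℝ × ℝ) →ₗ[ℝ] (ℝ × ℝ)}
    (hA : Function.Injective A) {b : ℝ × ℝ} (hP : ∀ x ∈ P, A x + b ∈ P) {x : ℝ × ℝ} (hx : x ∈ P)
    (hext : A x + b ∈ P.extremePoints ℝ) : x ∈ P.extremePoints ℝ := by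
  refine ⟨hx, fun y hy z hz hxyz => ?_⟩
  obtain ⟨s, t, hs, ht, hst, rfl⟩ := hxyz
  refine hA (add_right_cancel (hext.2 (hP y hy) (hP z hz) ⟨s, t, hs, ht, hst, ?_⟩))
  rw [map_add, map_smul, map_smul, smul_add, smul_add, add_add_add_comm, ← add_smul, hst, one_smul]

theorem exists_pos_of_ne_zero {ξ : (ℝ × ℝ) →ₗ[ℝ] ℝ} (hξ : ξ ≠ 0) : ∃ d, 0 < ξ d := by
  obtain ⟨d, hd⟩ : ∃ d, ξ d ≠ 0 := by
    by_contra! hcon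
    exact hξ (LinearMap.ext hcon)
  exact ⟨ξ d • d, by simpa using mul_self_pos.2 hd⟩

theorem mem_frontier_of_isMaxOn {P : Set (ℝ × ℝ)} {ξ : (ℝ × ℝ) →ₗ[ℝ] ℝ} (hξ : ξ ≠ 0)
    {x : ℝ × ℝ} (hx : x ∈ P) (hle : ∀ y ∈ P, ξ y ≤ ξ x) : x ∈ frontier P := by
  refine ⟨subset_closure hx, fun hint => ?_⟩
  obtain ⟨d, hd⟩ := exists_pos_of_ne_zero hξ
  have hcont : Continuous fun t : ℝ => x + t • d := by fun_prop
  have hev : ∀ᶠ t : ℝ in nhds 0, x + t • d ∈ P :=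
    hcont.continuousAt.eventually (by simpa using mem_interior_iff_mem_nhds.1 hint)
  obtain ⟨t, ht, ht0⟩ := ((hev.filter_mono nhdsWithin_le_nhds).and
    (self_mem_nhdsWithin : Set.Ioi (0 : ℝ) ∈ nhdsWithin 0 (Set.Ioi 0))).exists
  have h1 := hle _ ht
  have h2 : 0 < t * ξ d := mul_pos ht0 hd
  rw [map_add, map_smul, smul_eq_mul] at h1
  linarith

theorem exists_linearMap_forall_eq_zero {ξ : (ℝ × ℝ) →ₗ[ℝ] ℝ} (hξ : ξ ≠ 0) :
    ∃ η : (ℝ × ℝ) →ₗ[ℝ] ℝ, ∀ x, ξ x = 0 → η x = 0 → x = 0 := by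
  have hcoord : ∀ x : ℝ × ℝ, ξ x = x.1 * ξ (1, 0) + x.2 * ξ (0, 1) := fun x => by
    rw [← smul_eq_mul, ← smul_eq_mul, ← map_smul, ← map_smul, ← map_add]
    simp
  refine ⟨ξ (1, 0) • LinearMap.snd ℝ ℝ ℝ - ξ (0, 1) • LinearMap.fst ℝ ℝ ℝ, fun x h1 h2 => ?_⟩
  rw [hcoord] at h1
  simp only [LinearMap.sub_apply, LinearMap.smul_apply, LinearMap.snd_apply,
    LinearMap.fst_apply, smul_eq_mul] at h2
  have hpos : 0 < ξ (1, 0) ^ 2 + ξ (0, 1) ^ 2 := by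
    obtain ⟨d, hd⟩ := exists_pos_of_ne_zero hξ
    rw [hcoord] at hd
    by_contra! hle
    have h3 : ξ (1, 0) = 0 := by nlinarith [sq_nonneg (ξ (1, 0)), sq_nonneg (ξ (0, 1))]
    have h4 : ξ (0, 1) = 0 := by nlinarith [sq_nonneg (ξ (1, 0)), sq_nonneg (ξ (0, 1))]
    simp [h3, h4] at hd
  ext
  · refine (mul_eq_zero.1 (?_ : (ξ (1, 0) ^ 2 + ξ (0, 1) ^ 2) * x.1 = 0)).resolve_left hpos.ne'
    linear_combination ξ (1, 0) * h1 - ξ (0, 1) * h2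
  · refine (mul_eq_zero.1 (?_ : (ξ (1, 0) ^ 2 + ξ (0, 1) ^ 2) * x.2 = 0)).resolve_left hpos.ne'
    linear_combination ξ (0, 1) * h1 + ξ (1, 0) * h2

/-- A compact convex subset with two points of a line in the plane is a nondegenerate segment. -/
theorem exists_eq_segment {F : Set (ℝ × ℝ)} (hF : IsCompact F) (hconv : Convex ℝ F)
    {ξ : (ℝ × ℝ) →ₗ[ℝ] ℝ} (hξ : ξ ≠ 0) {c : ℝ} (hc : ∀ x ∈ F, ξ x = c)
    {p q : ℝ × ℝ} (hp : p ∈ F) (hq : q ∈ F) (hpq : p ≠ q) :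
    ∃ a b, a ≠ b ∧ F = segment ℝ a b := by
  obtain ⟨η, hη⟩ := exists_linearMap_forall_eq_zero hξ
  have hηc : ContinuousOn η F := η.continuous_of_finiteDimensional.continuousOn
  obtain ⟨a, ha, hmin⟩ := hF.exists_isMinOn ⟨p, hp⟩ hηc
  obtain ⟨b, hb, hmax⟩ := hF.exists_isMaxOn ⟨p, hp⟩ hηc
  have hinj : ∀ x ∈ F, ∀ y ∈ F, η x = η y → x = y := fun x hx y hy hxy =>
    sub_eq_zero.1 (hη _ (by rw [map_sub, hc x hx, hc y hy, sub_self])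
      (by rw [map_sub, hxy, sub_self]))
  have hab : η a < η b := by
    refine lt_of_le_of_ne (hmin hb) fun heq => hpq ?_
    have hconst : ∀ x ∈ F, η x = η a := fun x hx => le_antisymm (heq ▸ hmax hx) (hmin hx)
    exact hinj p hp q hq ((hconst p hp).trans (hconst q hq).symm)
  refine ⟨a, b, fun heq => hab.ne (congrArg η heq), (hconv.segment_subset ha hb).antisymm' ?_⟩
  intro x hx
  have hpos : 0 < η b - η a := sub_pos.2 hab
  have h1 : η a ≤ η x := hmin hx
  have h2 : η x ≤ η b := hmax hx
  have hmem : ((η b - η x) / (η b - η a)) • a + ((η x - η a) / (η b - η a)) • b ∈ segment ℝ a b :=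
    ⟨_, _, div_nonneg (sub_nonneg.2 h2) hpos.le, div_nonneg (sub_nonneg.2 h1) hpos.le,
      by rw [← add_div, sub_add_sub_cancel, div_self hpos.ne'], rfl⟩
  convert hmem
  refine hinj x hx _ (hconv.segment_subset ha hb hmem) ?_
  rw [map_add, map_smul, map_smul, smul_eq_mul, smul_eq_mul]
  field_simp
  ring

/-- In a compact convex set of the plane, the set of maximizers of a nonzero linear functional is
an edge as soon as it has two points. -/
theorem isEdge_of_isMaxOn {P : Set (ℝ × ℝ)} (hP : IsCompact P) (hconv : Convex ℝ P)
    {ξ : (ℝ × ℝ) →ₗ[ℝ] ℝ} (hξ : ξ ≠ 0) {c : ℝ} (hle : ∀ x ∈ P, ξ x ≤ c)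
    {p q : ℝ × ℝ} (hp : p ∈ P) (hpc : ξ p = c) (hq : q ∈ P) (hqc : ξ q = c) (hpq : p ≠ q) :
    IsEdge P {x ∈ P | ξ x = c} := by
  have hFc : IsCompact {x ∈ P | ξ x = c} :=
    hP.inter_right (isClosed_eq ξ.continuous_of_finiteDimensional continuous_const)
  have hFconv : Convex ℝ {x ∈ P | ξ x = c} := hconv.inter (convex_hyperplane ξ.isLinear c)
  refine ⟨exists_eq_segment hFc hFconv hξ (fun x hx => hx.2) ⟨hp, hpc⟩ ⟨hq, hqc⟩ hpq,
    fun x hx => mem_frontier_of_isMaxOn hξ hx.1 fun y hy => hx.2 ▸ hle y hy, fun a b hF hab => ?_⟩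
  have habP : segment ℝ a b ⊆ P := hab.trans hP.isClosed.frontier_subset
  have ha := habP (left_mem_segment ℝ a b)
  have hb := habP (right_mem_segment ℝ a b)
  obtain ⟨s, t, hs, ht, hst, rfl⟩ := hF ⟨hp, hpc⟩
  obtain ⟨s', t', hs', ht', hst', rfl⟩ := hF ⟨hq, hqc⟩
  simp only [map_add, map_smul, smul_eq_mul] at hpc hqc
  have hac := hle a ha
  have hbc := hle b hb
  obtain rfl : t = 1 - s := by linarith
  obtain rfl : t' = 1 - s' := by linarith
  have hss : s ≠ s' := fun heq => hpq (by rw [heq])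
  have key : (s - s') * (ξ a - ξ b) = 0 := by linear_combination hpc - hqc
  have hξab : ξ a - ξ b = 0 := (mul_eq_zero.1 key).resolve_left (sub_ne_zero.2 hss)
  have hξa : ξ a = c := by linear_combination hpc + (1 - s) * hξab
  exact (hFconv.segment_subset ⟨ha, hξa⟩ ⟨hb, by linarith⟩).antisymm hF

theorem IsEdge.exists_eq_setOf {P e : Set (ℝ × ℝ)} (hP : IsCompact P) (hconv : Convex ℝ P)
    (hint : (interior P).Nonempty) (he : IsEdge P e) :
    ∃ (ξ : (ℝ × ℝ) →ₗ[ℝ] ℝ) (c : ℝ), ξ ≠ 0 ∧ (∀ x ∈ P, ξ x ≤ c) ∧ e = {x ∈ P | ξ x = c} := by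
  obtain ⟨⟨a, b, hab, rfl⟩, hfr, hmax⟩ := he
  have hm := midpoint_mem_segment (𝕜 := ℝ) a b
  obtain ⟨ξ, hξ⟩ := geometric_hahn_banach_open_point hconv.interior isOpen_interior (hfr hm).2
  have hle : ∀ x ∈ P, ξ x ≤ ξ (midpoint ℝ a b) := by
    intro x hx
    have hcl : x ∈ closure (interior P) := by
      rw [hconv.closure_interior_eq_closure_of_nonempty_interior hint]
      exact subset_closure hx
    exact closure_minimal (fun y hy => (hξ y hy).le)
      (isClosed_le ξ.continuous continuous_const) hcl
  have hξ0 : (ξ : (ℝ × ℝ) →ₗ[ℝ] ℝ) ≠ 0 := by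
    intro h0
    obtain ⟨x, hx⟩ := hint
    have h1 := hξ x hx
    rw [← ContinuousLinearMap.coe_coe, h0] at h1
    exact lt_irrefl _ h1
  have hsub : segment ℝ a b ⊆ P := hfr.trans hP.isClosed.frontier_subset
  have ha := hsub (left_mem_segment ℝ a b)
  have hb := hsub (right_mem_segment ℝ a b)
  have hmid : ξ (midpoint ℝ a b) = (ξ a + ξ b) / 2 := by
    rw [midpoint_eq_smul_add, map_smul, map_add]
    simp
    ring
  have hac := hle a ha
  have hbc := hle b hb
  have ha' : ξ a = ξ (midpoint ℝ a b) := by linarith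
  have hb' : ξ b = ξ (midpoint ℝ a b) := by linarith
  obtain ⟨⟨a', b', -, heq⟩, hF, -⟩ := isEdge_of_isMaxOn hP hconv hξ0 hle ha ha' hb hb' hab
  refine ⟨ξ, ξ (midpoint ℝ a b), hξ0, hle, ?_⟩
  rw [heq] at hF ⊢
  refine (hmax a' b' ?_ hF).symm
  rw [← heq]
  exact (hconv.inter (convex_hyperplane (ξ : (ℝ × ℝ) →ₗ[ℝ] ℝ).isLinear _)).segment_subset
    ⟨ha, ha'⟩ ⟨hb, hb'⟩

/-- A face of a convex hull with two points contains two points of the generating set. -/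
theorem exists_mem_ne_of_convexHull {K : Set (ℝ × ℝ)} {ξ : (ℝ × ℝ) →ₗ[ℝ] ℝ} {c : ℝ}
    (hle : ∀ x ∈ K, ξ x ≤ c) {v w : ℝ × ℝ} (hv : ξ v = c) (hw : w ∈ convexHull ℝ K)
    (hwc : ξ w = c) (hwv : w ≠ v) : ∃ y ∈ K, ξ y = c ∧ y ≠ v := by
  by_contra! hcon
  have hconv : Convex ℝ ({x | ξ x < c} ∪ {v}) := by
    refine convex_iff_forall_pos.2 ?_
    rintro x hx y hy s t hs ht hst
    have hcs : s * c + t * c = c := by rw [← add_mul, hst, one_mul]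
    rcases hx with hx | rfl <;> rcases hy with hy | rfl
    · left
      rw [Set.mem_ofPred_eq] at hx hy ⊢
      rw [map_add, map_smul, map_smul, smul_eq_mul, smul_eq_mul]
      nlinarith
    · left
      rw [Set.mem_ofPred_eq] at hx ⊢
      rw [map_add, map_smul, map_smul, smul_eq_mul, smul_eq_mul]
      nlinarith
    · left
      rw [Set.mem_ofPred_eq] at hy ⊢
      rw [map_add, map_smul, map_smul, smul_eq_mul, smul_eq_mul]
      nlinarith
    · right
      rw [Set.mem_singleton_iff, ← add_smul, hst, one_smul]
  have hsub : K ⊆ {x | ξ x < c} ∪ {v} := fun y hy => by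
    rcases (hle y hy).lt_or_eq with h | h
    exacts [Or.inl h, Or.inr (hcon y hy h)]
  rcases convexHull_min hsub hconv hw with h | h
  exacts [h.ne hwc, hwv h]

theorem interior_convexHull_nonempty_of_not_onALine {K : Set (ℝ × ℝ)} (hne : K.Nonempty)
    (hK : ¬ OnALine K) : (interior (convexHull ℝ K)).Nonempty := by
  rw [interior_convexHull_nonempty_iff_affineSpan_eq_top]
  by_contra hspan
  obtain ⟨p, hp⟩ := hne
  have hdir : (affineSpan ℝ K).direction < ⊤ := by
    refine lt_top_iff_ne_top.2 fun h => hspan ?_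
    exact (AffineSubspace.direction_eq_top_iff_of_nonempty ⟨p, subset_affineSpan ℝ K hp⟩).1 h
  obtain ⟨ξ, hξ, hker⟩ := Submodule.exists_le_ker_of_lt_top _ hdir
  have hcoord : ∀ x : ℝ × ℝ, ξ x = ξ (1, 0) * x.1 + ξ (0, 1) * x.2 := fun x => by
    rw [mul_comm, mul_comm (ξ (0, 1)), ← smul_eq_mul, ← smul_eq_mul, ← map_smul, ← map_smul,
      ← map_add]
    simp
  refine hK ⟨ξ (1, 0), ξ (0, 1), ξ p, ?_, fun q hq => ?_⟩
  · by_contra! h0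
    refine hξ (LinearMap.ext fun x => ?_)
    rw [hcoord, h0.1, h0.2]
    simp
  · rw [← hcoord, ← sub_eq_zero, ← map_sub]
    exact hker (AffineSubspace.vsub_mem_direction (subset_affineSpan ℝ K hq)
      (subset_affineSpan ℝ K hp))

theorem IsCompact.isCompact_convexHull {E : Type*} [NormedAddCommGroup E] [NormedSpace ℝ E]
    [FiniteDimensional ℝ E] {K : Set E} (hK : IsCompact K) : IsCompact (convexHull ℝ K) := by
  let F : (m : ℕ) → (Fin m → ℝ) × (Fin m → E) → E := fun m q => ∑ i, q.1 i • q.2 i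
  have hF : convexHull ℝ K = ⋃ m ∈ Finset.range (Module.finrank ℝ E + 2),
      F m '' (stdSimplex ℝ (Fin m) ×ˢ Set.univ.pi fun _ => K) := by
    refine Set.Subset.antisymm (fun x hx => ?_) ?_
    · obtain ⟨ι, _, z, w, hz, hind, hw, hw1, rfl⟩ := eq_pos_convex_span_of_mem_convexHull hx
      let φ := (Fintype.equivFin ι).symm
      have hcard : Fintype.card ι ≤ Module.finrank ℝ E + 1 := hind.card_le_finrank_succ.trans
        (Nat.succ_le_succ (Submodule.finrank_le _))
      refine Set.mem_biUnion (x := Fintype.card ι) (Finset.mem_coe.2 (Finset.mem_range.2 (by omega)))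
        ⟨(w ∘ φ, z ∘ φ), ⟨⟨fun i => (hw _).le, ?_⟩, fun i _ => hz ⟨_, rfl⟩⟩, ?_⟩
      · exact (φ.sum_comp w).trans hw1
      · exact φ.sum_comp fun i => w i • z i
    · simp only [Set.iUnion_subset_iff]
      rintro m - _ ⟨q, ⟨⟨h0, h1⟩, hq⟩, rfl⟩
      exact (convex_convexHull ℝ K).sum_mem (fun i _ => h0 i) h1
        fun i _ => subset_convexHull ℝ K (hq i trivial)
  rw [hF]
  refine Finset.isCompact_biUnion _ fun m _ => IsCompact.image ?_ (by fun_prop)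
  exact (isCompact_stdSimplex ℝ (Fin m)).prod (isCompact_univ_pi fun _ => hK)

namespace IsSeparatedAttractor

variable {n : ℕ} {Λ : Finset (ℕ × ℕ)} {K : Set (ℝ × ℝ)}

theorem exists_map_eq_of_mem_extremePoints (h : IsSeparatedAttractor n Λ K) {v : ℝ × ℝ}
    (hv : v ∈ (convexHull ℝ K).extremePoints ℝ) :
    ∃ a ∈ Λ, ∃ y ∈ (convexHull ℝ K).extremePoints ℝ,
      y ∈ sierpMap n a '' K ∧ sierpMap n a y = v := by
  obtain ⟨a, ha, y, hy, hya⟩ := h.exists_map_eq v (extremePoints_convexHull_subset hv)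
  obtain ⟨b, hb, z, hz, rfl⟩ := h.exists_map_eq y hy
  have hn := h.pos
  have hn1 : (n : ℝ) + 1 ≠ 0 := by positivity
  have hp := h.map_mem b hb _ hy
  have heq := (mem_extremePoints.1 hv).2 _ (subset_convexHull ℝ K hp)
    _ (subset_convexHull ℝ K (h.map_mem a ha _ (h.map_mem a ha z hz)))
    ⟨1 / ((n : ℝ) + 1), n / ((n : ℝ) + 1), by positivity, by positivity,
    by rw [← add_div, add_comm, div_self hn1], by
      rw [← hya]
      ext <;> simp only [sierpMap, Prod.fst_add, Prod.snd_add, Prod.smul_fst, Prod.smul_snd,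
        smul_eq_mul] <;> field_simp <;> ring⟩
  obtain rfl : a = b := by
    by_contra hab
    exact (h.disjoint a ha b hb hab).ne_of_mem ⟨_, hy, rfl⟩ ⟨_, hy, rfl⟩ (hya.trans heq.1.symm)
  have hlin : ∀ x, ((n : ℝ)⁻¹ • LinearMap.id : (ℝ × ℝ) →ₗ[ℝ] ℝ × ℝ) x + sierpMap n a 0 =
      sierpMap n a x := fun x => by
    ext <;> simp [sierpMap] <;> ring
  refine ⟨a, ha, _, mem_extremePoints_of_map_mem (A := (n : ℝ)⁻¹ • LinearMap.id)
    (b := sierpMap n a 0) (fun x y hxy => ?_) (fun x hx => ?_) (subset_convexHull ℝ K hy) ?_,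
    ⟨z, hz, rfl⟩, hya⟩
  · simpa [hn.ne'] using hxy
  · exact convexHull_map_mem (fun x hx => by rw [hlin]; exact h.map_mem a ha x hx) hx
  · rwa [hlin, hya]

/-- Every extreme point of the convex hull of the attractor is fixed by one of its maps. -/
theorem exists_map_eq_self_of_mem_extremePoints (h : IsSeparatedAttractor n Λ K) {v : ℝ × ℝ}
    (hv : v ∈ (convexHull ℝ K).extremePoints ℝ) : ∃ a ∈ Λ, sierpMap n a v = v := by
  obtain ⟨a, ha, y, hy, -, hav⟩ := h.exists_map_eq_of_mem_extremePoints hv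
  refine ⟨a, ha, ?_⟩
  have hrep : ∀ k, ∃ y ∈ (convexHull ℝ K).extremePoints ℝ, y ∈ sierpMap n a '' K ∧
      sierpWordMap n (List.replicate k a) y = v := by
    intro k
    induction k with
    | zero => exact ⟨v, hv, ⟨y, extremePoints_convexHull_subset hy, hav⟩, rfl⟩
    | succ k ih =>
      obtain ⟨y, hy, hya, hyv⟩ := ih
      obtain ⟨b, hb, z, hz, hzb, hbz⟩ := h.exists_map_eq_of_mem_extremePoints hy
      have hzK := extremePoints_convexHull_subset hz
      obtain rfl : b = a := by
        by_contra hab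
        exact (h.disjoint b hb a ha hab).ne_of_mem ⟨z, hzK, hbz⟩ hya rfl
      refine ⟨z, hz, hzb, ?_⟩
      rw [List.replicate_succ', sierpWordMap_append, ← hyv, ← hbz]
      rfl
  refine eq_of_forall_dist_le fun ε hε => ?_
  obtain ⟨k, hk⟩ := (h.eventually_dist_wordMap_lt hε).exists
  obtain ⟨y, hy, -, hyv⟩ := hrep k
  have hyK := extremePoints_convexHull_subset hy
  have hcomm : sierpMap n a v = sierpWordMap n (List.replicate k a) (sierpMap n a y) := by
    have h1 := congrArg (fun l => sierpWordMap n l y)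
      ((List.replicate_succ (n := k) (a := a)).symm.trans List.replicate_succ')
    rw [sierpWordMap_cons, sierpWordMap_append, hyv] at h1
    exact h1
  rw [hcomm, ← hyv]
  exact (hk _ (mem_wordsOfLength.2 ⟨List.length_replicate, fun x hx =>
    List.eq_of_mem_replicate hx ▸ ha⟩) _ (h.map_mem a ha y hyK) _ hyK).le

/-- The points of `K` on a supporting line through an extreme point accumulate at that point. -/
theorem exists_mem_face_dist_lt (h : IsSeparatedAttractor n Λ K) {v : ℝ × ℝ}
    (hv : v ∈ (convexHull ℝ K).extremePoints ℝ) {ξ : (ℝ × ℝ) →ₗ[ℝ] ℝ} {y : ℝ × ℝ} (hy : y ∈ K)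
    (hξy : ξ y = ξ v) (hyv : y ≠ v) {ε : ℝ} (hε : 0 < ε) :
    ∃ z ∈ K, ξ z = ξ v ∧ z ≠ v ∧ dist z v < ε := by
  obtain ⟨a, ha, hav⟩ := h.exists_map_eq_self_of_mem_extremePoints hv
  have hfix : ∀ k, sierpWordMap n (List.replicate k a) v = v := fun k => by
    induction k with
    | zero => rfl
    | succ k ih => rw [List.replicate_succ, sierpWordMap_cons, ih, hav]
  obtain ⟨k, hk⟩ := (h.eventually_dist_wordMap_lt hε).exists
  have hmem : ∀ x ∈ List.replicate k a, x ∈ Λ := fun x hx => List.eq_of_mem_replicate hx ▸ ha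
  refine ⟨sierpWordMap n (List.replicate k a) y, h.wordMap_mem hmem hy, ?_, fun heq => ?_, ?_⟩
  · rw [← sub_eq_zero, ← map_sub]
    nth_rewrite 1 [← hfix k]
    rw [sierpWordMap_sub h.ne_zero, map_smul, map_sub, hξy, sub_self, smul_zero]
  · exact hyv (sierpWordMap_injective h.ne_zero _ (heq.trans (hfix k).symm))
  · nth_rewrite 1 [← hfix k]
    exact hk _ (mem_wordsOfLength.2 ⟨List.length_replicate, hmem⟩) y hy v
      (extremePoints_convexHull_subset hv)

/-- A cylinder at a given point of `K` which an affine map sends close to the image of the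
point. -/
theorem exists_word_forall_dist_lt (h : IsSeparatedAttractor n Λ K)
    (A : (ℝ × ℝ) →ₗ[ℝ] (ℝ × ℝ)) {x : ℝ × ℝ} (hx : x ∈ K) {ε : ℝ} (hε : 0 < ε) :
    ∃ w : List (ℕ × ℕ), w ≠ [] ∧ (∀ a ∈ w, a ∈ Λ) ∧ x ∈ sierpWordMap n w '' K ∧
      ∀ z ∈ K, dist (A (sierpWordMap n w z)) (A x) < ε := by
  obtain ⟨η, hη, hA⟩ := Metric.continuous_iff.1 A.continuous_of_finiteDimensional x ε hε
  obtain ⟨p, hp, hp1⟩ := ((h.eventually_dist_wordMap_lt hη).and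
    (Filter.eventually_ge_atTop 1)).exists
  obtain ⟨w, hw, y, hy, hyx⟩ := h.exists_wordMap_eq p hx
  obtain ⟨hlen, hmem⟩ := mem_wordsOfLength.1 hw
  refine ⟨w, fun h0 => ?_, hmem, ⟨y, hy, hyx⟩, fun z hz => hA _ ?_⟩
  · simp [h0] at hlen
    omega
  · rw [← hyx]
    exact hp w hw z hz y hy

theorem exists_words_vertex_edge (h : IsSeparatedAttractor n Λ K)
    {A : (ℝ × ℝ) →ₗ[ℝ] (ℝ × ℝ)} (hA : Function.Injective A) {b : ℝ × ℝ}
    (hK : ∀ x ∈ K, A x + b ∈ K) (hline : ¬ OnALine K) {v : ℝ × ℝ}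
    (hv : v ∈ (convexHull ℝ K).extremePoints ℝ) {e : Set (ℝ × ℝ)} (he : IsEdge (convexHull ℝ K) e)
    (hve : ∃ w, e = segment ℝ v w) :
    ∃ (u w : List (ℕ × ℕ)) (v' : ℝ × ℝ) (e' : Set (ℝ × ℝ)), u ≠ [] ∧ w ≠ [] ∧
      (∀ x ∈ u, x ∈ Λ) ∧ (∀ x ∈ w, x ∈ Λ) ∧ v' ∈ (convexHull ℝ K).extremePoints ℝ ∧
      IsEdge (convexHull ℝ K) e' ∧ A (sierpWordMap n w v') + b = sierpWordMap n u v ∧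
      ∀ x ∈ e', A (sierpWordMap n w x) + b ∈ sierpWordMap n u '' e := by
  have hP : IsCompact (convexHull ℝ K) := h.isCompact.isCompact_convexHull
  have hconv : Convex ℝ (convexHull ℝ K) := convex_convexHull ℝ K
  have hn := h.pos
  have hvK := extremePoints_convexHull_subset hv
  obtain ⟨w₀, hw₀⟩ := hve
  have hw₀v : w₀ ≠ v := by
    rintro rfl
    obtain ⟨p, q, hpq, heq⟩ := he.1
    rw [segment_same] at hw₀
    rw [hw₀] at heq
    have h1 : p ∈ ({w₀} : Set (ℝ × ℝ)) := heq ▸ left_mem_segment ℝ p q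
    have h2 : q ∈ ({w₀} : Set (ℝ × ℝ)) := heq ▸ right_mem_segment ℝ p q
    exact hpq (h1.trans h2.symm)
  obtain ⟨ξ, c, hξ, hle, hec⟩ := he.exists_eq_setOf hP hconv
    (interior_convexHull_nonempty_of_not_onALine h.nonempty hline)
  have hve : v ∈ {x ∈ convexHull ℝ K | ξ x = c} := hec ▸ hw₀ ▸ left_mem_segment ℝ v w₀
  have hwe : w₀ ∈ {x ∈ convexHull ℝ K | ξ x = c} := hec ▸ hw₀ ▸ right_mem_segment ℝ v w₀
  obtain ⟨y, hy, hyc, hyv⟩ := exists_mem_ne_of_convexHull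
    (fun x hx => hle x (subset_convexHull ℝ K hx)) hve.2 hwe.1 hwe.2 hw₀v
  obtain ⟨u, hu, huΛ, hsub⟩ := h.exists_word_image_subset hA hK
  obtain ⟨δ, hδ, hsep⟩ := h.exists_mem_wordMap_image_of_dist_lt
  obtain ⟨x, hx, hxv⟩ := hsub ⟨v, hvK, rfl⟩
  obtain ⟨w, hw, hwΛ, ⟨v', hv', hv'x⟩, hwdist⟩ := h.exists_word_forall_dist_lt A hx
    (ε := ((n : ℝ) ^ u.length)⁻¹ * δ) (by positivity)
  obtain ⟨C, -, hAC⟩ := A.exists_antilipschitzWith (LinearMap.ker_eq_bot.2 hA)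
  have hC : (0 : ℝ) < C + 1 := by positivity
  obtain ⟨z, hz, hzξ, hzv, hzd⟩ := h.exists_mem_face_dist_lt hv hy (hyc.trans hve.2.symm) hyv
    (ε := ((n : ℝ) ^ w.length)⁻¹ * δ / (C + 1)) (by positivity)
  obtain ⟨x', hx', hx'z⟩ := hsub ⟨z, hz, rfl⟩
  have hx'x : dist x' x < ((n : ℝ) ^ w.length)⁻¹ * δ := by
    have hpow : ((n : ℝ) ^ u.length)⁻¹ ≤ 1 := inv_le_one_of_one_le₀ (one_le_pow₀ h.one_lt.le)
    calc dist x' x ≤ C * dist (A x') (A x) := hAC.le_mul_dist _ _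
      _ = C * (((n : ℝ) ^ u.length)⁻¹ * dist z v) := by
          rw [← dist_add_right _ _ b]
          dsimp only at hx'z hxv
          rw [hx'z, hxv, dist_sierpWordMap h.ne_zero]
      _ ≤ (C + 1) * dist z v := by
          gcongr
          · linarith
          · exact mul_le_of_le_one_left dist_nonneg hpow
      _ < _ := by rwa [mul_comm, ← lt_div_iff₀ hC]
  obtain ⟨z', hz', hz'x⟩ := hsep _ w (mem_wordsOfLength.2 ⟨rfl, hwΛ⟩) x' hx' x
    ⟨v', hv', hv'x⟩ hx'x
  obtain ⟨t, ht⟩ := exists_wordMap_comp_eq h.ne_zero A b u w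
  set s := (n : ℝ) ^ u.length * ((n : ℝ) ^ w.length)⁻¹ with hs
  have hs0 : s ≠ 0 := by positivity
  have hsA : Function.Injective (s • A) := fun p q hpq => hA (smul_right_injective _ hs0 hpq)
  have hinj := sierpWordMap_injective h.ne_zero u
  have hgK : ∀ p ∈ K, (s • A) p + t ∈ K := by
    intro p hp
    have hmem : A (sierpWordMap n w p) + b ∈ sierpWordMap n u '' K := by
      refine hsep _ u (mem_wordsOfLength.2 ⟨rfl, huΛ⟩) _ (hK _ (h.wordMap_mem hwΛ hp)) _
        ⟨v, hvK, rfl⟩ ?_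
      rw [← hxv, dist_add_right]
      exact hwdist p hp
    obtain ⟨q, hq, hqp⟩ := hmem
    rw [ht] at hqp
    exact hinj hqp ▸ hq
  have hgv : (s • A) v' + t = v := hinj (by
    rw [← hxv, ← hv'x]
    exact (ht v').symm)
  have hgz : (s • A) z' + t = z := hinj (by
    rw [← hx'z, ← hz'x]
    exact (ht z').symm)
  have hgP : ∀ p ∈ convexHull ℝ K, (s • A) p + t ∈ convexHull ℝ K := fun p hp =>
    convexHull_map_mem hgK hp
  have hiff : ∀ p, (ξ ∘ₗ (s • A)) p = c - ξ t ↔ ξ ((s • A) p + t) = c := fun p => by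
    rw [map_add, eq_sub_iff_add_eq]
    rfl
  have hξ' : ξ ∘ₗ (s • A) ≠ 0 := fun h0 => hξ (LinearMap.ext fun p => by
    obtain ⟨q, rfl⟩ := LinearMap.injective_iff_surjective.1 hsA p
    exact LinearMap.congr_fun h0 q)
  have hv'P := subset_convexHull ℝ K hv'
  refine ⟨u, w, v', {p ∈ convexHull ℝ K | (ξ ∘ₗ (s • A)) p = c - ξ t}, hu, hw, huΛ, hwΛ,
    mem_extremePoints_of_map_mem hsA hgP hv'P (hgv.symm ▸ hv), ?_, ?_, ?_⟩
  · refine isEdge_of_isMaxOn hP hconv hξ' (fun p hp => ?_) hv'P ?_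
      (subset_convexHull ℝ K hz') ?_ fun hvz => ?_
    · have := hle _ (hgP p hp)
      rw [map_add] at this
      exact le_sub_iff_add_le.2 this
    · rw [hiff, hgv, hve.2]
    · rw [hiff, hgz, hzξ, hve.2]
    · rw [← hvz, hgv] at hgz
      exact hzv hgz.symm
  · rw [hv'x]
    exact hxv
  · rintro p ⟨hp, hpc⟩
    rw [ht, hec]
    exact ⟨_, ⟨hgP p hp, (hiff p).1 hpc⟩, rfl⟩

end IsSeparatedAttractor

theorem vertex_and_edge_mapped_into_copies
    (n : ℕ) (Λ : Finset (ℕ × ℕ))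
    (hn : 2 ≤ n)
    (hΛsub : Λ ⊆ Finset.range n ×ˢ Finset.range n)
    (hΛ1 : 1 < Λ.card) (hΛ2 : Λ.card < n * n)
    (hssc : StrongSep n Λ)
    (hline : ¬ OnALine (BMCarpet n n Λ))
    (f : ℝ × ℝ → ℝ × ℝ) (l : ℝ) (hl : 0 < l)
    (hf : IsSimilitude f l)
    (hsub : f '' BMCarpet n n Λ ⊆ BMCarpet n n Λ)
    (v : ℝ × ℝ) (hv : v ∈ (convexHull ℝ (BMCarpet n n Λ)).extremePoints ℝ)
    (e : Set (ℝ × ℝ)) (he : IsEdge (convexHull ℝ (BMCarpet n n Λ)) e)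
    (hve : ∃ w : ℝ × ℝ, e = segment ℝ v w) :
    ∃ (u w : List (ℕ × ℕ)) (v' : ℝ × ℝ) (e' : Set (ℝ × ℝ)),
      u ≠ [] ∧ w ≠ [] ∧ (∀ x ∈ u, x ∈ Λ) ∧ (∀ x ∈ w, x ∈ Λ) ∧
      v' ∈ (convexHull ℝ (BMCarpet n n Λ)).extremePoints ℝ ∧
      IsEdge (convexHull ℝ (BMCarpet n n Λ)) e' ∧
      f (sierpWordMap n w v') = sierpWordMap n u v ∧
      f '' (sierpWordMap n w '' e') ⊆ sierpWordMap n u '' e := by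
  have h := isSeparatedAttractor_bmCarpet hn hΛsub (Finset.card_pos.1 (by omega)) hssc
  obtain ⟨A, hA, hfA⟩ := hf.exists_linearMap hl
  have hK : ∀ x ∈ BMCarpet n n Λ, A x + f 0 ∈ BMCarpet n n Λ := fun x hx =>
    hfA x ▸ hsub ⟨x, hx, rfl⟩
  obtain ⟨u, w, v', e', hu, hw, huΛ, hwΛ, hv', he', h1, h2⟩ :=
    h.exists_words_vertex_edge hA hK hline hv he hve
  refine ⟨u, w, v', e', hu, hw, huΛ, hwΛ, hv', he', hfA _ ▸ h1, ?_⟩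
  rintro _ ⟨_, ⟨x, hx, rfl⟩, rfl⟩
  exact hfA _ ▸ h2 x hx
end

section
/- Let K = K(n,Λ) be a generalized Sierpiński carpet satisfying the strong separation condition and not contained in any affine line of ℝ². Let θ ∈ ℝ with θ/π rational, let R_θ be the counterclockwise rotation of ℝ² about the origin by angle θ, and let f(x) = λ R_θ x + a with λ > 0 and a ∈ ℝ². If f is oblique (equivalently, sin θ ≠ 0 and cos θ ≠ 0) and f(K) ⊆ K, then |tan θ| = 1. -/
open scoped BigOperators

section DigitExpansion

variable {D : Type*} (n : ℕ) (e : D → ℂ)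

/-- The point `Σ_k e (u k) n^{-(k+1)}` of the plane with base-`n` address `u`. -/
noncomputable def addressPoint (u : ℕ → D) : ℂ := ∑' k : ℕ, e (u k) / (n : ℂ) ^ (k + 1)

variable {n} {e}

lemma exists_norm_digit_le [Finite D] (e : D → ℂ) : ∃ C : ℝ, 0 ≤ C ∧ ∀ d, ‖e d‖ ≤ C := by
  obtain ⟨C, hC⟩ := (Set.finite_range fun d => ‖e d‖).bddAbove
  exact ⟨max C 0, le_max_right _ _, fun d => (hC ⟨d, rfl⟩).trans (le_max_left _ _)⟩

lemma norm_digit_div_le {C : ℝ} (hC : ∀ d, ‖e d‖ ≤ C) (u : ℕ → D) (k : ℕ) :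
    ‖e (u k) / (n : ℂ) ^ (k + 1)‖ ≤ C * ((n : ℝ)⁻¹) ^ (k + 1) := by
  rw [norm_div, norm_pow, Complex.norm_natCast, inv_pow, ← div_eq_mul_inv]
  gcongr
  exact hC _

lemma summable_digit_bound (hn : 2 ≤ n) (C : ℝ) :
    Summable fun k : ℕ => C * ((n : ℝ)⁻¹) ^ (k + 1) := by
  have h : (n : ℝ)⁻¹ < 1 := inv_lt_one_of_one_lt₀ (by exact_mod_cast hn)
  exact ((summable_nat_add_iff 1).2
    (summable_geometric_of_lt_one (by positivity) h)).mul_left C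

lemma summable_digit [Finite D] (hn : 2 ≤ n) (u : ℕ → D) :
    Summable fun k : ℕ => e (u k) / (n : ℂ) ^ (k + 1) := by
  obtain ⟨C, -, hC⟩ := exists_norm_digit_le e
  exact .of_norm_bounded (summable_digit_bound hn C) (norm_digit_div_le hC u)

lemma addressPoint_eq [Finite D] (hn : 2 ≤ n) (u : ℕ → D) :
    addressPoint n e u = (e (u 0) + addressPoint n e fun k => u (k + 1)) / n := by
  rw [addressPoint, (summable_digit hn u).tsum_eq_zero_add, addressPoint, add_div,
    ← tsum_div_const]
  simp [pow_succ, div_div]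

lemma continuous_addressPoint [Finite D] [TopologicalSpace D] [DiscreteTopology D] (hn : 2 ≤ n) :
    Continuous (addressPoint n e) := by
  obtain ⟨C, -, hC⟩ := exists_norm_digit_le e
  refine continuous_tsum (fun k => ?_) (summable_digit_bound hn C)
    fun k u => norm_digit_div_le hC u k
  exact ((continuous_of_discreteTopology (f := e)).comp (continuous_apply k)).div_const _

lemma isCompact_range_addressPoint [Finite D] (hn : 2 ≤ n) :
    IsCompact (Set.range (addressPoint n e)) := by
  let _ : TopologicalSpace D := ⊥
  have _ : DiscreteTopology D := ⟨rfl⟩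
  exact isCompact_range (continuous_addressPoint hn)

lemma exists_gap [Finite D] (hn : 2 ≤ n)
    (hsep : ∀ u v : ℕ → D, u 0 ≠ v 0 → addressPoint n e u ≠ addressPoint n e v) :
    ∃ δ : ℝ, 0 < δ ∧ ∀ u v : ℕ → D, u 0 ≠ v 0 →
      δ ≤ ‖addressPoint n e u - addressPoint n e v‖ := by
  let _ : TopologicalSpace D := ⊥
  have _ : DiscreteTopology D := ⟨rfl⟩
  set S : Set ((ℕ → D) × (ℕ → D)) := {p | p.1 0 ≠ p.2 0}
  have hS : IsCompact S := by
    refine IsClosed.isCompact ?_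
    have : Continuous fun p : (ℕ → D) × (ℕ → D) => (p.1 0, p.2 0) := by fun_prop
    exact (isClosed_discrete {q : D × D | q.1 ≠ q.2}).preimage this
  have hf : Continuous fun p : (ℕ → D) × (ℕ → D) =>
      ‖addressPoint n e p.1 - addressPoint n e p.2‖ := by
    have := continuous_addressPoint (e := e) hn
    fun_prop
  rcases S.eq_empty_or_nonempty with h0 | h0
  · refine ⟨1, one_pos, fun u v huv => ?_⟩
    have : (u, v) ∈ S := huv
    simp [h0] at this
  · obtain ⟨p, hp, hmin⟩ := hS.exists_isMinOn h0 hf.continuousOn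
    exact ⟨_, norm_pos_iff.2 (sub_ne_zero.2 (hsep _ _ hp)), fun u v huv => hmin (a := (u, v)) huv⟩

lemma gap_div_pow_le [Finite D] (hn : 2 ≤ n) {δ : ℝ} (hδ : 0 < δ)
    (hgap : ∀ u v : ℕ → D, u 0 ≠ v 0 → δ ≤ ‖addressPoint n e u - addressPoint n e v‖) (i : ℕ) :
    ∀ u v : ℕ → D, u i ≠ v i → δ / n ^ i ≤ ‖addressPoint n e u - addressPoint n e v‖ := by
  have hn1 : (1 : ℝ) ≤ n := by exact_mod_cast (by omega : 1 ≤ n)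
  induction i with
  | zero => simpa using hgap
  | succ i ih =>
    intro u v huv
    by_cases h : u 0 = v 0
    · rw [addressPoint_eq hn u, addressPoint_eq hn v, h, ← sub_div, add_sub_add_left_eq_sub,
        norm_div, Complex.norm_natCast, pow_succ, ← div_div]
      gcongr
      exact ih _ _ huv
    · exact (div_le_self hδ.le (one_le_pow₀ hn1)).trans (hgap u v h)

lemma eq_of_norm_sub_lt [Finite D] (hn : 2 ≤ n) {δ : ℝ} (hδ : 0 < δ)
    (hgap : ∀ u v : ℕ → D, u 0 ≠ v 0 → δ ≤ ‖addressPoint n e u - addressPoint n e v‖)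
    {u v : ℕ → D} {k : ℕ} (h : ‖addressPoint n e u - addressPoint n e v‖ < δ / n ^ k) :
    ∀ i ≤ k, u i = v i := by
  intro i hi
  by_contra huv
  have hn1 : (1 : ℝ) ≤ n := by exact_mod_cast (by omega : 1 ≤ n)
  have h1 := gap_div_pow_le hn hδ hgap i u v huv
  have h2 : δ / n ^ k ≤ δ / n ^ i := by gcongr
  linarith

lemma addressPoint_injective [Finite D] (hn : 2 ≤ n) {δ : ℝ} (hδ : 0 < δ)
    (hgap : ∀ u v : ℕ → D, u 0 ≠ v 0 → δ ≤ ‖addressPoint n e u - addressPoint n e v‖) :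
    Function.Injective (addressPoint n e) := by
  intro u v huv
  funext i
  refine eq_of_norm_sub_lt hn hδ hgap (k := i) ?_ i le_rfl
  rw [huv, sub_self, norm_zero]
  have : (0 : ℝ) < n := by exact_mod_cast (by omega : 0 < n)
  positivity

/-- The `n`-adic numerator of the first `k` digits of the address `u`. -/
def addressPrefix {A : Type*} [AddMonoid A] (n : ℕ) (u : ℕ → A) : ℕ → A
  | 0 => 0
  | k + 1 => n • addressPrefix n u k + u k

lemma addressPrefix_congr {A : Type*} [AddMonoid A] {u v : ℕ → A} {k : ℕ}
    (h : ∀ i < k, u i = v i) : addressPrefix n u k = addressPrefix n v k := by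
  induction k with
  | zero => rfl
  | succ k ih => simp only [addressPrefix, ih fun i hi => h i (by omega), h k (by omega)]

lemma addressPoint_eq_addressPrefix_add [Finite D] (hn : 2 ≤ n) (u : ℕ → D) (k : ℕ) :
    addressPoint n e u =
      (addressPrefix n (fun i => e (u i)) k + addressPoint n e fun i => u (i + k)) / n ^ k := by
  have hn0 : (n : ℂ) ≠ 0 := by exact_mod_cast (by omega : n ≠ 0)
  induction k with
  | zero => simp [addressPrefix]
  | succ k ih =>
    rw [ih, addressPoint_eq hn fun i => u (i + k)]
    simp only [addressPrefix, zero_add, nsmul_eq_mul]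
    rw [show (fun i => u (i + 1 + k)) = fun i => u (i + (k + 1)) by
      funext i; congr 1; omega]
    field_simp
    ring

end DigitExpansion

section SelfSimilarMeasure

open MeasureTheory Measure ENNReal NNReal Filter Topology

variable {D : Type*} [Fintype D] {n : ℕ} {e : D → ℂ}

lemma natCast_rpow_logb (hn : 2 ≤ n) {N : ℕ} (hN : 2 ≤ N) : (n : ℝ) ^ Real.logb n N = N := by
  have : (2 : ℝ) ≤ n := by exact_mod_cast hn
  exact Real.rpow_logb (by linarith) (by linarith) (by exact_mod_cast (by omega : 0 < N))

lemma logb_natCast_pos (hn : 2 ≤ n) {N : ℕ} (hN : 2 ≤ N) : 0 < Real.logb n N :=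
  Real.logb_pos (by exact_mod_cast hn) (by exact_mod_cast hN)

lemma inv_pow_rpow_logb (hn : 2 ≤ n) {N : ℕ} (hN : 2 ≤ N) (k : ℕ) :
    (((n : ℝ) ^ k)⁻¹) ^ Real.logb n N = ((N : ℝ) ^ k)⁻¹ := by
  rw [Real.inv_rpow (by positivity), ← Real.rpow_pow_comm (by positivity), natCast_rpow_logb hn hN]

lemma exists_dist_addressPoint_le (hn : 2 ≤ n) (e : D → ℂ) :
    ∃ R : ℝ, 0 < R ∧ ∀ u v : ℕ → D, ‖addressPoint n e u - addressPoint n e v‖ ≤ R := by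
  obtain ⟨R, hR⟩ := (Metric.isBounded_iff.1 (isCompact_range_addressPoint (e := e) hn).isBounded)
  refine ⟨max R 1, by positivity, fun u v => ?_⟩
  rw [← dist_eq_norm]
  exact (hR ⟨u, rfl⟩ ⟨v, rfl⟩).trans (le_max_left _ _)

lemma norm_sub_le_of_agree (hn : 2 ≤ n) {R : ℝ}
    (hR : ∀ u v : ℕ → D, ‖addressPoint n e u - addressPoint n e v‖ ≤ R) {u v : ℕ → D} {k : ℕ}
    (h : ∀ i < k, u i = v i) : ‖addressPoint n e u - addressPoint n e v‖ ≤ R / n ^ k := by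
  have hp : addressPrefix n (fun i => e (u i)) k = addressPrefix n (fun i => e (v i)) k :=
    addressPrefix_congr fun i hi => congrArg e (h i hi)
  rw [addressPoint_eq_addressPrefix_add hn u k, addressPoint_eq_addressPrefix_add hn v k, hp, ← _root_.sub_div,
    add_sub_add_left_eq_sub, norm_div, norm_pow, Complex.norm_natCast]
  gcongr
  exact hR _ _

lemma hausdorffMeasure_range_lt_top (hn : 2 ≤ n) (hD : 2 ≤ Fintype.card D) :
    μH[Real.logb n (Fintype.card D)] (Set.range (addressPoint n e)) < ∞ := by
  classical
  set s := Real.logb n (Fintype.card D) with hs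
  have hs0 : 0 < s := logb_natCast_pos hn hD
  obtain ⟨R, hR0, hR⟩ := exists_dist_addressPoint_le hn e
  have hn1 : (1 : ℝ) < n := by exact_mod_cast hn
  let t : (k : ℕ) → (Fin k → D) → Set ℂ :=
    fun k w => {z | ∃ u : ℕ → D, (∀ i : Fin k, u i = w i) ∧ addressPoint n e u = z}
  have hdiam : ∀ k w, Metric.ediam (t k w) ≤ ENNReal.ofReal (R / n ^ k) := by
    intro k w
    refine Metric.ediam_le ?_
    rintro _ ⟨u, hu, rfl⟩ _ ⟨v, hv, rfl⟩
    rw [edist_dist, dist_eq_norm]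
    refine ENNReal.ofReal_le_ofReal (norm_sub_le_of_agree hn hR fun i hi => ?_)
    rw [hu ⟨i, hi⟩, hv ⟨i, hi⟩]
  have htend : Tendsto (fun k : ℕ => ENNReal.ofReal (R / n ^ k)) atTop (𝓝 0) := by
    rw [← ENNReal.ofReal_zero]
    refine ENNReal.tendsto_ofReal ?_
    exact tendsto_const_nhds.div_atTop (tendsto_pow_atTop_atTop_of_one_lt hn1)
  have hle := hausdorffMeasure_le_liminf_sum s (Set.range (addressPoint n e)) _ htend t
    (Eventually.of_forall hdiam) (Eventually.of_forall fun k => by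
      rintro _ ⟨u, rfl⟩
      exact Set.mem_iUnion.2 ⟨fun i => u i, u, fun _ => rfl, rfl⟩)
  refine hle.trans_lt (lt_of_le_of_lt ?_ (ENNReal.ofReal_lt_top (r := R ^ s)))
  refine (liminf_le_liminf (v := fun _ => ENNReal.ofReal (R ^ s))
    (Eventually.of_forall fun k => ?_)).trans_eq (liminf_const _)
  have hbound : ∀ w ∈ (Finset.univ : Finset (Fin k → D)), Metric.ediam (t k w) ^ s ≤
      ENNReal.ofReal (R ^ s * ((Fintype.card D : ℝ) ^ k)⁻¹) := by
    intro w _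
    refine (ENNReal.rpow_le_rpow (hdiam k w) hs0.le).trans_eq ?_
    rw [ENNReal.ofReal_rpow_of_nonneg (by positivity) hs0.le, div_eq_mul_inv,
      Real.mul_rpow hR0.le (by positivity), inv_pow_rpow_logb hn hD]
  refine (Finset.sum_le_card_nsmul _ _ _ hbound).trans_eq ?_
  have hD0 : (0 : ℝ) < Fintype.card D := by exact_mod_cast (by omega : 0 < Fintype.card D)
  rw [Finset.card_univ, Fintype.card_fun, Fintype.card_fin, nsmul_eq_mul,
    ← ENNReal.ofReal_natCast, ← ENNReal.ofReal_mul (by positivity)]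
  congr 1
  push_cast
  field_simp

lemma hausdorffMeasure_range_pos (hn : 2 ≤ n) (hD : 2 ≤ Fintype.card D) {δ : ℝ} (hδ : 0 < δ)
    (hgap : ∀ u v : ℕ → D, u 0 ≠ v 0 → δ ≤ ‖addressPoint n e u - addressPoint n e v‖) :
    0 < μH[Real.logb n (Fintype.card D)] (Set.range (addressPoint n e)) := by
  classical
  set s := Real.logb n (Fintype.card D) with hs
  have hs0 : 0 < s := logb_natCast_pos hn hD
  have hn0 : (0 : ℝ) < n := by exact_mod_cast (by omega : 0 < n)
  have : Nonempty D := Fintype.card_pos_iff.1 (by omega)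
  let σ := Fintype.equivFin D
  have hinj := addressPoint_injective hn hδ hgap
  let g : ℂ → ℝ := fun z => Real.ofDigits fun i => σ (Function.invFun (addressPoint n e) z i)
  have hg : ∀ u, g (addressPoint n e u) = Real.ofDigits fun i => σ (u i) := fun u => by
    simp only [g, Function.leftInverse_invFun hinj u]
  have himage : Set.Icc (0 : ℝ) 1 ⊆ g '' Set.range (addressPoint n e) := by
    intro x hx
    obtain ⟨a, -, rfl⟩ := Real.ofDigits_SurjOn (b := Fintype.card D) (by omega) hx
    exact ⟨_, ⟨fun i => σ.symm (a i), rfl⟩, by simp [hg]⟩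
  have hreal : ∀ u v : ℕ → D, dist (g (addressPoint n e u)) (g (addressPoint n e v)) ≤
      (δ⁻¹) ^ s * dist (addressPoint n e u) (addressPoint n e v) ^ s := by
    intro u v
    by_cases huv : u = v
    · rw [huv, dist_self]; positivity
    have hex : ∃ i, u i ≠ v i := Function.ne_iff.1 huv
    have hlow := gap_div_pow_le hn hδ hgap _ u v (Nat.find_spec hex)
    rw [hg, hg, Real.dist_eq]
    refine (Real.abs_ofDigits_sub_ofDigits_le (n := Nat.find hex) fun i hi => ?_).trans ?_
    · exact congrArg σ (not_not.1 (Nat.find_min hex hi))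
    · rw [← inv_pow_rpow_logb hn hD, ← Real.mul_rpow (by positivity) dist_nonneg, dist_eq_norm]
      refine Real.rpow_le_rpow (by positivity) ?_ hs0.le
      calc ((n : ℝ) ^ Nat.find hex)⁻¹ = δ⁻¹ * (δ / n ^ Nat.find hex) := by field_simp
        _ ≤ _ := by gcongr
  have hHolder : HolderOnWith (Real.toNNReal ((δ⁻¹) ^ s)) (Real.toNNReal s) g
      (Set.range (addressPoint n e)) := by
    rintro _ ⟨u, rfl⟩ _ ⟨v, rfl⟩
    rw [Real.coe_toNNReal _ hs0.le, edist_dist, edist_dist,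
      ENNReal.ofReal_rpow_of_nonneg dist_nonneg hs0.le, ← ENNReal.ofReal,
      ← ENNReal.ofReal_mul (by positivity)]
    exact ENNReal.ofReal_le_ofReal (hreal u v)
  have h1 := hHolder.hausdorffMeasure_image_le (Real.toNNReal_pos.2 hs0) zero_le_one
  rw [hausdorffMeasure_real, Real.coe_toNNReal _ hs0.le, mul_one] at h1
  rw [pos_iff_ne_zero]
  intro h0
  rw [h0, mul_zero] at h1
  have h2 := (measure_mono (μ := volume) himage).trans h1
  simp at h2

/-- The address which follows `u` for the first `k` digits and continues with `v`. -/
def spliceAddress (u : ℕ → D) (k : ℕ) (v : ℕ → D) : ℕ → D :=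
  fun i => if i < k then u i else v (i - k)

lemma addressPoint_splice (hn : 2 ≤ n) (u : ℕ → D) (k : ℕ) (v : ℕ → D) :
    addressPoint n e (spliceAddress u k v) =
      (addressPrefix n (fun i => e (u i)) k + addressPoint n e v) / n ^ k := by
  rw [addressPoint_eq_addressPrefix_add hn _ k]
  congr 2
  · refine addressPrefix_congr fun i hi => ?_
    simp [spliceAddress, hi]
  · simp [spliceAddress]

open scoped Pointwise in
lemma hausdorffMeasure_affine_image {s : ℝ} (hs : 0 ≤ s) {w : ℂ} (hw : w ≠ 0) (b : ℂ)
    (X : Set ℂ) : μH[s] ((fun z => w * z + b) '' X) = ‖w‖₊ ^ s • μH[s] X := by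
  have h : (fun z => w * z + b) '' X = (fun z => z + b) '' (w • X) := by
    rw [← Set.image_smul, Set.image_image]; rfl
  rw [h, (isometry_add_right b).hausdorffMeasure_image (Or.inl hs), hausdorffMeasure_smul₀ hs hw]

lemma hausdorffMeasure_cylinder_image (hn : 2 ≤ n) (hD : 2 ≤ Fintype.card D) (p : ℂ) (k : ℕ)
    (X : Set ℂ) :
    μH[Real.logb n (Fintype.card D)] ((fun z => (p + z) / (n : ℂ) ^ k) '' X) =
      ((Fintype.card D : ℝ≥0) ^ k)⁻¹ • μH[Real.logb n (Fintype.card D)] X := by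
  have hn0 : (n : ℂ) ≠ 0 := by exact_mod_cast (by omega : n ≠ 0)
  have h : (fun z => (p + z) / (n : ℂ) ^ k) = fun z => ((n : ℂ) ^ k)⁻¹ * z + p / n ^ k := by
    funext z; field_simp; ring
  rw [h, hausdorffMeasure_affine_image (logb_natCast_pos hn hD).le (by positivity)]
  congr 1
  rw [← NNReal.coe_inj]
  simpa using inv_pow_rpow_logb hn hD k

lemma measurableSet_affine_image {w : ℂ} (hw : w ≠ 0) (b : ℂ) {X : Set ℂ} (hX : MeasurableSet X) :
    MeasurableSet ((fun z => w * z + b) '' X) := by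
  have h : (fun z => w * z + b) '' X = (fun z => w⁻¹ * (z - b)) ⁻¹' X := by
    ext z
    constructor
    · rintro ⟨x, hx, rfl⟩
      simpa [hw] using hx
    · intro hz
      exact ⟨_, hz, by field_simp; ring⟩
  rw [h]
  exact hX.preimage (by fun_prop)

/-- Near an extreme point of `K` in the direction `-t`, the translate `K + t` misses `K`. -/
lemma measure_sdiff_translate_ge_of_le_norm (hn : 2 ≤ n) (hD : 2 ≤ Fintype.card D) {R : ℝ}
    (hR : ∀ u v : ℕ → D, ‖addressPoint n e u - addressPoint n e v‖ ≤ R) {k : ℕ} {t : ℂ}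
    (ht : R / n ^ k < ‖t‖) :
    ((Fintype.card D : ℝ≥0) ^ k)⁻¹ •
        μH[Real.logb n (Fintype.card D)] (Set.range (addressPoint n e)) ≤
      μH[Real.logb n (Fintype.card D)]
        (Set.range (addressPoint n e) \ (fun z => z + t) '' Set.range (addressPoint n e)) := by
  have : Nonempty D := Fintype.card_pos_iff.1 (by omega)
  have hcont : Continuous fun z : ℂ => (z * (starRingEnd ℂ) t).re := by fun_prop
  obtain ⟨_, ⟨u, rfl⟩, hmin⟩ := (isCompact_range_addressPoint (e := e) hn).exists_isMinOn
    (Set.range_nonempty _) hcont.continuousOn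
  rw [← hausdorffMeasure_cylinder_image hn hD (addressPrefix n (fun i => e (u i)) k) k]
  refine measure_mono ?_
  rintro _ ⟨_, ⟨v, rfl⟩, rfl⟩
  beta_reduce
  rw [← addressPoint_splice hn u k v]
  refine ⟨⟨_, rfl⟩, ?_⟩
  rintro ⟨_, ⟨v', rfl⟩, hv'⟩
  have h1 := norm_sub_le_of_agree (e := e) hn hR (u := spliceAddress u k v) (v := u) (k := k)
    fun i hi => by simp [spliceAddress, hi]
  rw [← hv'] at h1
  have h2 : (addressPoint n e u * (starRingEnd ℂ) t).re ≤
    (addressPoint n e v' * (starRingEnd ℂ) t).re := hmin ⟨v', rfl⟩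
  have h3 : ((addressPoint n e v' + t - addressPoint n e u) * (starRingEnd ℂ) t).re ≤
      ‖addressPoint n e v' + t - addressPoint n e u‖ * ‖t‖ := by
    refine (Complex.re_le_norm _).trans_eq ?_
    rw [norm_mul, RCLike.norm_conj]
  have h4 : (t * (starRingEnd ℂ) t).re = ‖t‖ ^ 2 := by
    rw [Complex.mul_conj, Complex.ofReal_re, Complex.normSq_eq_norm_sq]
  rw [sub_mul, add_mul, Complex.sub_re, Complex.add_re, h4] at h3
  have h5 : 0 ≤ ‖t‖ := norm_nonneg _
  have h6 : 0 ≤ ‖addressPoint n e v' + t - addressPoint n e u‖ := norm_nonneg _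
  nlinarith

lemma measure_sdiff_translate_mul_le (hn : 2 ≤ n) (hD : 2 ≤ Fintype.card D) {δ : ℝ}
    (hgap : ∀ u v : ℕ → D, u 0 ≠ v 0 → δ ≤ ‖addressPoint n e u - addressPoint n e v‖) {t : ℂ}
    (ht : ‖t‖ < δ) :
    μH[Real.logb n (Fintype.card D)]
        (Set.range (addressPoint n e) \ (fun z => z + n * t) '' Set.range (addressPoint n e)) ≤
      μH[Real.logb n (Fintype.card D)]
        (Set.range (addressPoint n e) \ (fun z => z + t) '' Set.range (addressPoint n e)) := by
  classical
  set s := Real.logb n (Fintype.card D)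
  set K := Set.range (addressPoint n e)
  set Y := K \ (fun z => z + n * t) '' K
  have hn0 : (n : ℂ) ≠ 0 := by exact_mod_cast (by omega : n ≠ 0)
  have hK : IsCompact K := isCompact_range_addressPoint hn
  have hY : MeasurableSet Y :=
    hK.measurableSet.diff (hK.image (by fun_prop)).measurableSet
  have hcons : ∀ (d : D) (v : ℕ → D), addressPoint n e (spliceAddress (fun _ => d) 1 v) =
      (e d + addressPoint n e v) / n ^ 1 := fun d v => by
    rw [addressPoint_splice hn]; simp [addressPrefix]
  let φ : D → ℂ → ℂ := fun d z => (e d + z) / n ^ 1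
  have hsub : (⋃ d, φ d '' Y) ⊆ K \ (fun z => z + t) '' K := by
    refine Set.iUnion_subset fun d => ?_
    rintro _ ⟨_, ⟨⟨v, rfl⟩, hv⟩, rfl⟩
    simp only [φ]
    rw [← hcons]
    refine ⟨⟨_, rfl⟩, ?_⟩
    rintro ⟨_, ⟨v', rfl⟩, hv'⟩
    have h0 : spliceAddress (fun _ => d) 1 v 0 = v' 0 := by
      by_contra hne
      have := hgap _ _ hne
      rw [← hv'] at this
      simp only [add_sub_cancel_left] at this
      linarith
    have hd : d = v' 0 := h0
    refine hv ⟨_, ⟨fun k => v' (k + 1), rfl⟩, ?_⟩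
    simp only
    rw [hcons, addressPoint_eq hn v', ← hd] at hv'
    field_simp at hv'
    linear_combination hv'
  have hdisj : Pairwise (Function.onFun Disjoint fun d => φ d '' Y) := by
    intro d d' hdd'
    rw [Function.onFun, Set.disjoint_left]
    rintro _ ⟨_, ⟨⟨v, rfl⟩, -⟩, rfl⟩ ⟨_, ⟨⟨v', rfl⟩, -⟩, hv'⟩
    simp only [φ] at hv'
    rw [← hcons, ← hcons] at hv'
    have h := hgap (spliceAddress (fun _ => d') 1 v') (spliceAddress (fun _ => d) 1 v)
      (fun h => hdd' h.symm)
    rw [hv', sub_self, norm_zero] at h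
    exact absurd (norm_nonneg t) (by linarith)
  have hmeas : ∀ d, MeasurableSet (φ d '' Y) := fun d => by
    have h : φ d = fun z => (n : ℂ)⁻¹ * z + e d / n := by
      funext z; simp only [φ]; field_simp; ring
    rw [h]
    exact measurableSet_affine_image (inv_ne_zero hn0) _ hY
  refine le_trans (le_of_eq ?_) (measure_mono hsub)
  rw [measure_iUnion hdisj hmeas, tsum_fintype]
  have hφ : ∀ d, μH[s] (φ d '' Y) = ((Fintype.card D : ℝ≥0) ^ 1)⁻¹ • μH[s] Y :=
    fun d => hausdorffMeasure_cylinder_image hn hD (e d) 1 Y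
  simp only [hφ]
  rw [Finset.sum_const, Finset.card_univ, pow_one, ← Nat.cast_smul_eq_nsmul ℝ≥0, smul_smul,
    mul_inv_cancel₀ (by exact_mod_cast (by omega : Fintype.card D ≠ 0)), one_smul]

lemma exists_pos_le_measure_sdiff_translate (hn : 2 ≤ n) (hD : 2 ≤ Fintype.card D) {δ : ℝ}
    (hδ : 0 < δ)
    (hgap : ∀ u v : ℕ → D, u 0 ≠ v 0 → δ ≤ ‖addressPoint n e u - addressPoint n e v‖) :
    ∃ c : ℝ≥0∞, 0 < c ∧ ∀ t : ℂ, t ≠ 0 → c ≤ μH[Real.logb n (Fintype.card D)]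
      (Set.range (addressPoint n e) \ (fun z => z + t) '' Set.range (addressPoint n e)) := by
  obtain ⟨R, hR0, hR⟩ := exists_dist_addressPoint_le hn e
  have hn1 : (1 : ℝ) < n := by exact_mod_cast hn
  obtain ⟨k, hk⟩ := pow_unbounded_of_one_lt (R / δ) hn1
  have hk' : R / n ^ k < δ := by
    rw [div_lt_iff₀ (by positivity)]
    rw [div_lt_iff₀ hδ] at hk
    linarith
  refine ⟨((Fintype.card D : ℝ≥0) ^ k)⁻¹ •
    μH[Real.logb n (Fintype.card D)] (Set.range (addressPoint n e)), ?_, ?_⟩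
  · refine pos_iff_ne_zero.2 (smul_ne_zero ?_ (hausdorffMeasure_range_pos hn hD hδ hgap).ne')
    exact inv_ne_zero (pow_ne_zero _ (by exact_mod_cast (by omega : Fintype.card D ≠ 0)))
  · suffices h : ∀ (j : ℕ) (t : ℂ), δ ≤ n ^ j * ‖t‖ → _ ≤ μH[Real.logb n (Fintype.card D)]
        (Set.range (addressPoint n e) \ (fun z => z + t) '' Set.range (addressPoint n e)) by
      intro t ht
      obtain ⟨j, hj⟩ := pow_unbounded_of_one_lt (δ / ‖t‖) hn1
      rw [div_lt_iff₀ (norm_pos_iff.2 ht)] at hj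
      exact h j t hj.le
    intro j
    induction j with
    | zero =>
      intro t ht
      refine measure_sdiff_translate_ge_of_le_norm hn hD hR (hk'.trans_le ?_)
      simpa using ht
    | succ j ih =>
      intro t ht
      rcases le_or_gt δ ‖t‖ with h | h
      · exact measure_sdiff_translate_ge_of_le_norm hn hD hR (hk'.trans_le h)
      · refine (ih (n * t) ?_).trans (measure_sdiff_translate_mul_le hn hD hgap h)
        rw [norm_mul, Complex.norm_natCast, ← mul_assoc, ← pow_succ]
        exact ht

lemma finite_translations (hn : 2 ≤ n) (hD : 2 ≤ Fintype.card D) {δ : ℝ} (hδ : 0 < δ)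
    (hgap : ∀ u v : ℕ → D, u 0 ≠ v 0 → δ ≤ ‖addressPoint n e u - addressPoint n e v‖)
    {w : ℂ} (hw : w ≠ 0) :
    {b : ℂ | ∀ z ∈ Set.range (addressPoint n e), w * z + b ∈ Set.range (addressPoint n e)}.Finite
    := by
  have : Nonempty D := Fintype.card_pos_iff.1 (by omega)
  obtain ⟨c, hc, hcle⟩ := exists_pos_le_measure_sdiff_translate hn hD hδ hgap
  have hfin := hausdorffMeasure_range_lt_top (e := e) hn hD
  have hK := isCompact_range_addressPoint (e := e) hn
  have hs0 : 0 < Real.logb n (Fintype.card D) := logb_natCast_pos hn hD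
  set s := Real.logb n (Fintype.card D)
  obtain ⟨x₀, hx₀⟩ : (Set.range (addressPoint n e)).Nonempty := Set.range_nonempty _
  set K := Set.range (addressPoint n e)
  set S : Set ℂ := {b : ℂ | ∀ z ∈ K, w * z + b ∈ K}
  by_contra hinf
  have hSK : S ⊆ (fun z => z - w * x₀) '' K := fun b hb => ⟨_, hb x₀ hx₀, by ring⟩
  obtain ⟨a, -, ha⟩ := Set.Infinite.exists_accPt_of_subset_isCompact hinf
    (hK.image (by fun_prop)) hSK
  set B := (fun z => w * z + a) '' K
  have hB : IsCompact B := hK.image (by fun_prop)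
  have : IsFiniteMeasure ((μH[s] : Measure ℂ).restrict K) :=
    ⟨by rwa [Measure.restrict_apply_univ]⟩
  have hε : ‖w‖₊ ^ s • c ≠ 0 :=
    smul_ne_zero (NNReal.rpow_pos (nnnorm_pos.2 hw)).ne' hc.ne'
  obtain ⟨U, hBU, hU, hlt⟩ := Set.exists_isOpen_lt_add (μ := (μH[s] : Measure ℂ).restrict K) B
    (measure_ne_top _ _) hε
  obtain ⟨r, hr, hrU⟩ := hB.exists_thickening_subset_open hU hBU
  obtain ⟨b, ⟨hbr, hbS⟩, hba⟩ := accPt_iff_nhds.1 ha _ (Metric.ball_mem_nhds a hr)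
  have hsub : (fun z => w * z + b) '' (K \ (fun z => z + (a - b) / w) '' K) ⊆ (U \ B) ∩ K := by
    rintro _ ⟨z, ⟨hz, hz'⟩, rfl⟩
    refine ⟨⟨hrU (Metric.mem_thickening_iff.2 ⟨_, ⟨z, hz, rfl⟩, ?_⟩), ?_⟩, hbS z hz⟩
    · simpa using hbr
    · rintro ⟨y, hy, hyz⟩
      refine hz' ⟨y, hy, ?_⟩
      simp only at hyz ⊢
      field_simp
      linear_combination hyz
  have h1 := measure_mono (μ := (μH[s] : Measure ℂ)) hsub
  rw [hausdorffMeasure_affine_image hs0.le hw,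
    ← Measure.restrict_apply (hU.measurableSet.diff hB.measurableSet),
    measure_sdiff hBU hB.measurableSet.nullMeasurableSet (measure_ne_top _ _)] at h1
  have h2 : ‖w‖₊ ^ s • c ≤ ‖w‖₊ ^ s • μH[s] (K \ (fun z => z + (a - b) / w) '' K) := by
    gcongr
    exact hcle _ (div_ne_zero (sub_ne_zero.2 hba.symm) hw)
  have h3 := ENNReal.sub_lt_of_lt_add (measure_mono hBU) (by rwa [add_comm] at hlt)
  exact absurd (h2.trans h1) (not_le.2 h3)

/-- Zooming in on a self-embedding `z ↦ w z + a` of `K` at the cylinder of `u` of level `j + q`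
gives a self-embedding with linear part `w / n ^ q`. -/
lemma exists_zoomed_translation (hn : 2 ≤ n) {δ : ℝ} (hδ : 0 < δ)
    (hgap : ∀ u v : ℕ → D, u 0 ≠ v 0 → δ ≤ ‖addressPoint n e u - addressPoint n e v‖)
    {R : ℝ} (hR : ∀ u v : ℕ → D, ‖addressPoint n e u - addressPoint n e v‖ ≤ R) {w a : ℂ}
    (hf : ∀ z ∈ Set.range (addressPoint n e), w * z + a ∈ Set.range (addressPoint n e)) {q : ℕ}
    (hq : ‖w‖ * (R / n ^ q) < δ) (j : ℕ) (u : ℕ → D) :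
    ∃ x : ℕ → D, ∀ z ∈ Set.range (addressPoint n e),
      w / n ^ q * z + (w / n ^ q * addressPrefix n (fun i => e (u i)) (j + q) + n ^ j * a -
        addressPrefix n (fun i => e (x i)) j) ∈ Set.range (addressPoint n e) := by
  have hn0 : (n : ℂ) ≠ 0 := by exact_mod_cast (by omega : n ≠ 0)
  have hn1 : (0 : ℝ) < n := by exact_mod_cast (by omega : 0 < n)
  choose! x hx using fun v : ℕ → D =>
    hf _ ⟨spliceAddress u (j + q) v, rfl⟩
  refine ⟨x u, ?_⟩
  rintro _ ⟨v, rfl⟩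
  have hagree : ∀ i ≤ j, x v i = x u i := by
    refine eq_of_norm_sub_lt hn hδ hgap ?_
    rw [hx, hx, add_sub_add_right_eq_sub, ← mul_sub, norm_mul]
    refine (mul_le_mul_of_nonneg_left (norm_sub_le_of_agree hn hR (k := j + q) ?_)
      (norm_nonneg w)).trans_lt ?_
    · intro i hi
      simp [spliceAddress, hi]
    · rw [lt_div_iff₀ (by positivity)]
      calc _ = ‖w‖ * (R / n ^ q) := by rw [pow_add]; field_simp
        _ < δ := hq
  have hp : addressPrefix n (fun i => e (x v i)) j = addressPrefix n (fun i => e (x u i)) j :=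
    addressPrefix_congr fun i hi => congrArg e (hagree i hi.le)
  refine ⟨fun i => x v (i + j), ?_⟩
  have h := hx v
  rw [addressPoint_splice hn, addressPoint_eq_addressPrefix_add hn (x v) j, hp, pow_add] at h
  field_simp at h ⊢
  linear_combination h

/-- The linear part of a self-embedding of `K` is a ratio of differences of address prefixes. -/
theorem exists_prefix_relation (hn : 2 ≤ n) (hD : 2 ≤ Fintype.card D)
    (hsep : ∀ u v : ℕ → D, u 0 ≠ v 0 → addressPoint n e u ≠ addressPoint n e v) {w a : ℂ}
    (hw : w ≠ 0)
    (hf : ∀ z ∈ Set.range (addressPoint n e), w * z + a ∈ Set.range (addressPoint n e)) :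
    ∃ (q k j : ℕ) (u v x y : ℕ → D),
      addressPrefix n (fun i => e (u i)) k ≠ addressPrefix n (fun i => e (v i)) k ∧
      w * (addressPrefix n (fun i => e (u i)) k - addressPrefix n (fun i => e (v i)) k) =
        n ^ q * (addressPrefix n (fun i => e (x i)) j - addressPrefix n (fun i => e (y i)) j) := by
  classical
  obtain ⟨δ, hδ, hgap⟩ := exists_gap hn hsep
  obtain ⟨R, hR0, hR⟩ := exists_dist_addressPoint_le hn e
  have hn0 : (n : ℂ) ≠ 0 := by exact_mod_cast (by omega : n ≠ 0)
  have hn1 : (1 : ℝ) < n := by exact_mod_cast hn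
  obtain ⟨q, hq⟩ := pow_unbounded_of_one_lt (‖w‖ * R / δ) hn1
  have hq' : ‖w‖ * (R / n ^ q) < δ := by
    rw [div_lt_iff₀ hδ] at hq
    rw [← mul_div_assoc, div_lt_iff₀ (by positivity)]
    linarith
  have hfin := finite_translations hn hD hδ hgap (div_ne_zero hw (pow_ne_zero q hn0))
  set M := hfin.toFinset.card
  obtain ⟨d₀, d₁, hd⟩ := Fintype.exists_pair_of_one_lt_card (α := D) (by omega)
  choose X hX using exists_zoomed_translation hn hδ hgap hR hf hq' (M + 1)
  let U : ℕ → ℕ → D := fun i l => if l = i then d₁ else d₀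
  obtain ⟨i, hi, i', hi', hii', heq⟩ := Finset.exists_ne_map_eq_of_card_lt_of_maps_to
    (s := Finset.range (M + 1)) (t := hfin.toFinset) (by simp [M])
    (f := fun i => w / n ^ q * addressPrefix n (fun l => e (U i l)) (M + 1 + q) +
      n ^ (M + 1) * a - addressPrefix n (fun l => e (X (U i) l)) (M + 1))
    (fun i _ => by rw [Set.Finite.coe_toFinset]; exact hX (U i))
  refine ⟨q, M + 1 + q, M + 1, U i, U i', X (U i), X (U i'), fun hpre => ?_, ?_⟩
  · have htail : ∀ i ∈ Finset.range (M + 1), (fun l => U i (l + (M + 1 + q))) = fun _ => d₀ := by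
      intro i hi
      funext l
      have := Finset.mem_range.1 hi
      exact if_neg (by omega)
    have hpt : addressPoint n e (U i) = addressPoint n e (U i') := by
      rw [addressPoint_eq_addressPrefix_add hn (U i) (M + 1 + q),
        addressPoint_eq_addressPrefix_add hn (U i') (M + 1 + q), hpre, htail i hi, htail i' hi']
    have := congrFun (addressPoint_injective hn hδ hgap hpt) i
    simp only [U, if_true, if_neg hii'] at this
    exact hd this.symm
  · field_simp at heq
    linear_combination heq

end SelfSimilarMeasure

lemma exists_int_addressPrefix {D : Type*} {n : ℕ} {e : D → ℂ}
    (he : ∀ d, ∃ p q : ℤ, e d = p + q * Complex.I) (u : ℕ → D) (k : ℕ) :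
    ∃ p q : ℤ, addressPrefix n (fun i => e (u i)) k = p + q * Complex.I := by
  induction k with
  | zero => exact ⟨0, 0, by simp [addressPrefix]⟩
  | succ k ih =>
    obtain ⟨p, q, h⟩ := ih
    obtain ⟨p', q', h'⟩ := he (u k)
    refine ⟨n * p + p', n * q + q', ?_⟩
    simp only [addressPrefix, h, h', nsmul_eq_mul]
    push_cast
    ring

lemma int_sq_ne_three_mul_sq {x y : ℝ} (hx : ∃ p : ℤ, x = p) (hy : ∃ p : ℤ, y = p) (hy0 : y ≠ 0) :
    x ^ 2 ≠ 3 * y ^ 2 := by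
  obtain ⟨p, rfl⟩ := hx
  obtain ⟨q, rfl⟩ := hy
  intro h
  have hirr : Irrational (√3 : ℝ) := by simpa using Nat.prime_three.irrational_sqrt
  refine hirr ⟨|p / q|, ?_⟩
  push_cast
  rw [← Real.sqrt_sq_eq_abs, div_pow, h, mul_div_assoc, div_self (pow_ne_zero 2 hy0), mul_one]

/-- If the direction of angle `θ ∈ ℚπ` is spanned by an integer vector, it is a coordinate or a
diagonal direction. -/
lemma abs_tan_eq_one_of_int_direction {θ μ : ℝ} (hθ : ∃ q : ℚ, θ = q * Real.pi) (hμ : μ ≠ 0)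
    (hsin : Real.sin θ ≠ 0) (hcos : Real.cos θ ≠ 0) (hA : ∃ p : ℤ, μ * Real.cos θ = p)
    (hB : ∃ p : ℤ, μ * Real.sin θ = p) : |Real.tan θ| = 1 := by
  have hsc := Real.sin_sq_add_cos_sq θ
  have h2 : Real.cos (2 * θ) = Real.cos θ ^ 2 - Real.sin θ ^ 2 := by
    rw [Real.cos_two_mul]; linarith
  have hrat : ∃ q : ℚ, Real.cos (2 * θ) = q := by
    obtain ⟨p, hp⟩ := hA
    obtain ⟨q, hq⟩ := hB
    refine ⟨(p ^ 2 - q ^ 2) / (p ^ 2 + q ^ 2), ?_⟩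
    push_cast
    have hden : (p : ℝ) ^ 2 + q ^ 2 = μ ^ 2 := by
      rw [← hp, ← hq]; linear_combination μ ^ 2 * hsc
    rw [hden, ← hp, ← hq, h2]
    field_simp
  have hniven := niven (θ := 2 * θ)
    (by obtain ⟨q, rfl⟩ := hθ; exact ⟨2 * q, by push_cast; ring⟩) hrat
  have hA0 := mul_ne_zero hμ hcos
  have hB0 := mul_ne_zero hμ hsin
  simp only [Set.mem_insert_iff, Set.mem_singleton_iff, h2] at hniven
  rcases hniven with h | h | h | h | h
  · exact absurd (pow_eq_zero_iff (two_ne_zero) |>.1 (by linarith : Real.cos θ ^ 2 = 0)) hcos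
  · refine absurd ?_ (int_sq_ne_three_mul_sq hB hA hA0)
    linear_combination μ ^ 2 * (-2 * h - hsc)
  · rw [Real.tan_eq_sin_div_cos, abs_div, div_eq_one_iff_eq (abs_ne_zero.2 hcos),
      ← sq_eq_sq_iff_abs_eq_abs]
    linarith
  · refine absurd ?_ (int_sq_ne_three_mul_sq hA hB hB0)
    linear_combination μ ^ 2 * (2 * h - hsc)
  · exact absurd (pow_eq_zero_iff (two_ne_zero) |>.1 (by linarith : Real.sin θ ^ 2 = 0)) hsin

/-- A pair of digits as a complex number. -/
def digitToComplex (d : ℕ × ℕ) : ℂ := d.1 + d.2 * Complex.I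

lemma addressPoint_digitToComplex {n : ℕ} {Λ : Finset (ℕ × ℕ)} (hn : 2 ≤ n) (u : ℕ → Λ) :
    (addressPoint n (fun d : Λ => digitToComplex d) u).re =
        ∑' k : ℕ, ((u k).1.1 : ℝ) / (n : ℝ) ^ (k + 1) ∧
      (addressPoint n (fun d : Λ => digitToComplex d) u).im =
        ∑' k : ℕ, ((u k).1.2 : ℝ) / (n : ℝ) ^ (k + 1) := by
  have hs := summable_digit (e := fun d : Λ => digitToComplex d) hn u
  have hpow : ∀ k : ℕ, (n : ℂ) ^ (k + 1) = (((n : ℝ) ^ (k + 1) : ℝ) : ℂ) := fun k => by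
    push_cast; rfl
  constructor
  · rw [addressPoint, Complex.re_tsum hs]
    refine tsum_congr fun k => ?_
    rw [hpow, Complex.div_ofReal_re]
    simp [digitToComplex]
  · rw [addressPoint, Complex.im_tsum hs]
    refine tsum_congr fun k => ?_
    rw [hpow, Complex.div_ofReal_im]
    simp [digitToComplex]

lemma mem_BMCarpet_iff {n : ℕ} {Λ : Finset (ℕ × ℕ)} (hn : 2 ≤ n) (z : ℂ) :
    (z.re, z.im) ∈ BMCarpet n n Λ ↔
      z ∈ Set.range (addressPoint n (fun d : Λ => digitToComplex d)) := by
  constructor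
  · rintro ⟨d, hd, h1, h2⟩
    have h := addressPoint_digitToComplex hn fun k => (⟨d k, hd k⟩ : Λ)
    exact ⟨_, Complex.ext (h.1.trans h1.symm) (h.2.trans h2.symm)⟩
  · rintro ⟨u, rfl⟩
    have h := addressPoint_digitToComplex hn u
    exact ⟨fun k => u k, fun k => (u k).2, h.1, h.2⟩

lemma StrongSep.addressPoint_ne {n : ℕ} {Λ : Finset (ℕ × ℕ)} (hn : 2 ≤ n) (h : StrongSep n Λ)
    (u v : ℕ → Λ) (huv : u 0 ≠ v 0) :
    addressPoint n (fun d : Λ => digitToComplex d) u ≠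
      addressPoint n (fun d : Λ => digitToComplex d) v := by
  have hmem : ∀ u : ℕ → Λ, ((addressPoint n (fun d : Λ => digitToComplex d) u).re,
      (addressPoint n (fun d : Λ => digitToComplex d) u).im) ∈
        sierpMap n (u 0) '' BMCarpet n n Λ := by
    intro u
    refine ⟨_, (mem_BMCarpet_iff hn _).2 ⟨fun k => u (k + 1), rfl⟩, ?_⟩
    rw [addressPoint_eq hn u, sierpMap]
    simp [digitToComplex, add_comm]
  intro heq
  have hv := hmem v
  rw [← heq] at hv
  exact Set.disjoint_left.1 (h _ (u 0).2 _ (v 0).2 fun h => huv (Subtype.ext h)) (hmem u) hv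

theorem oblique_rational_rotation_tan_eq_one
    (n : ℕ) (Λ : Finset (ℕ × ℕ))
    (hn : 2 ≤ n)
    (hΛsub : Λ ⊆ Finset.range n ×ˢ Finset.range n)
    (hΛ1 : 1 < Λ.card) (hΛ2 : Λ.card < n * n)
    (hssc : StrongSep n Λ)
    (hline : ¬ OnALine (BMCarpet n n Λ))
    (θ lam : ℝ) (a : ℝ × ℝ) (hlam : 0 < lam)
    (hθ : ∃ q : ℚ, θ = (q : ℝ) * Real.pi)
    (f : ℝ × ℝ → ℝ × ℝ)
    (hfdef : ∀ p : ℝ × ℝ, f p =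
      (lam * (Real.cos θ * p.1 - Real.sin θ * p.2) + a.1,
       lam * (Real.sin θ * p.1 + Real.cos θ * p.2) + a.2))
    (hsin : Real.sin θ ≠ 0) (hcos : Real.cos θ ≠ 0)
    (hsub : f '' BMCarpet n n Λ ⊆ BMCarpet n n Λ) :
    |Real.tan θ| = 1 := by
  have hD : 2 ≤ Fintype.card Λ := by rw [Fintype.card_coe]; exact hΛ1
  set w : ℂ := ⟨lam * Real.cos θ, lam * Real.sin θ⟩ with hw
  have hw0 : w ≠ 0 := fun h => mul_ne_zero hlam.ne' hcos (congrArg Complex.re h)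
  have hf : ∀ z ∈ Set.range (addressPoint n (fun d : Λ => digitToComplex d)),
      w * z + ⟨a.1, a.2⟩ ∈ Set.range (addressPoint n (fun d : Λ => digitToComplex d)) := by
    intro z hz
    rw [← mem_BMCarpet_iff hn] at hz ⊢
    have h := hsub ⟨_, hz, rfl⟩
    rw [hfdef] at h
    convert h using 2
    · simp [hw]; ring
    · simp [hw]; ring
  obtain ⟨Q, k, j, u, v, x, y, hne, hrel⟩ :=
    exists_prefix_relation hn hD (hssc.addressPoint_ne hn) hw0 hf
  have hint : ∀ (u : ℕ → Λ) (k : ℕ), ∃ p q : ℤ,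
      addressPrefix n (fun i => digitToComplex (u i)) k = p + q * Complex.I :=
    exists_int_addressPrefix (e := fun d : Λ => digitToComplex d) fun d => ⟨d.1.1, d.1.2, by simp [digitToComplex]⟩
  obtain ⟨p₁, q₁, h₁⟩ := hint u k
  obtain ⟨p₂, q₂, h₂⟩ := hint v k
  obtain ⟨p₃, q₃, h₃⟩ := hint x j
  obtain ⟨p₄, q₄, h₄⟩ := hint y j
  rw [h₁, h₂] at hne
  rw [h₁, h₂, h₃, h₄] at hrel
  have hpow : (n : ℂ) ^ Q = (((n : ℝ) ^ Q : ℝ) : ℂ) := by push_cast; rfl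
  rw [hpow] at hrel
  have hre := congrArg Complex.re hrel
  have him := congrArg Complex.im hrel
  simp only [hw, Complex.mul_re, Complex.mul_im, Complex.sub_re, Complex.sub_im, Complex.add_re,
    Complex.add_im, Complex.intCast_re, Complex.intCast_im, Complex.I_re, Complex.I_im,
    Complex.ofReal_re, Complex.ofReal_im] at hre him
  have hpq : ((p₁ - p₂ : ℤ) : ℝ) ^ 2 + ((q₁ - q₂ : ℤ) : ℝ) ^ 2 ≠ 0 := by
    intro h
    have hp : p₁ - p₂ = 0 := by
      exact_mod_cast pow_eq_zero_iff two_ne_zero |>.1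
        (le_antisymm (by nlinarith [sq_nonneg ((q₁ - q₂ : ℤ) : ℝ)])
          (sq_nonneg ((p₁ - p₂ : ℤ) : ℝ)))
    have hq : q₁ - q₂ = 0 := by
      exact_mod_cast pow_eq_zero_iff two_ne_zero |>.1
        (le_antisymm (by nlinarith [sq_nonneg ((p₁ - p₂ : ℤ) : ℝ)])
          (sq_nonneg ((q₁ - q₂ : ℤ) : ℝ)))
    exact hne (by rw [sub_eq_zero.1 hp, sub_eq_zero.1 hq])
  refine abs_tan_eq_one_of_int_direction hθ (mul_ne_zero hlam.ne' hpq) hsin hcos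
    ⟨n ^ Q * ((p₃ - p₄) * (p₁ - p₂) + (q₃ - q₄) * (q₁ - q₂)), ?_⟩
    ⟨n ^ Q * ((q₃ - q₄) * (p₁ - p₂) - (p₃ - p₄) * (q₁ - q₂)), ?_⟩
  · push_cast
    linear_combination ((p₁ : ℝ) - p₂) * hre + ((q₁ : ℝ) - q₂) * him
  · push_cast
    linear_combination ((p₁ : ℝ) - p₂) * him - ((q₁ : ℝ) - q₂) * hre
end
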